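/- arXiv:1211.4974 — 9 statements merged into one kernel-verified Lean document; each statement's English description precedes it below -/
import Mathlib

section
/- (i) Let q, r, B be real with 0 < q ≤ 1, 0 < r < 1 and B ≥ 1. Then for every natural number n ≥ 1 and every natural number m with m ≥ ((n + log₂ B)/log₂(1/r))^(1/q) one has B·r^(m^q) ≤ 2^(−n); in particular B·r^(m^q) ≤ 2^(−n) holds for all m ≥ C·n^(1/q), where C := ((1 + log₂ B)/log₂(1/r))^(1/q). (ii) Conversely, let q, C be real with 0 < q < 1 ≤ C and let ε : ℕ → ℝ be a sequence such that ε_m ≤ 2^(−n) holds for all natural numbers n and m with m ≥ C·n^(1/q). Then, setting r := 2^(−C^(−q)), one has 1/2 ≤ r < 1 and ε_m ≤ 2·r^(m^q) for every m ∈ ℕ. -/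
theorem mul_rpow_le_two_rpow_neg {r B x M : ℝ} (hr0 : 0 < r) (hr1 : r < 1) (hB : 0 < B)
    (h : (x + Real.logb 2 B) / Real.logb 2 (1 / r) ≤ M) :
    B * r ^ M ≤ (2 : ℝ) ^ (-x) := by
  have hlog : 0 < Real.logb 2 (1 / r) :=
    Real.logb_pos one_lt_two ((one_lt_div hr0).2 hr1)
  rw [div_le_iff₀ hlog, one_div, Real.logb_inv] at h
  have hrM : 0 < r ^ M := Real.rpow_pos_of_pos hr0 M
  rw [← Real.logb_le_iff_le_rpow one_lt_two (mul_pos hB hrM),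
    Real.logb_mul hB.ne' hrM.ne', Real.logb_rpow_eq_mul_logb_of_pos hr0]
  linarith

theorem le_two_mul_rpow_of_le_two_rpow_neg {q C x e : ℝ} (hq : 0 < q) (hC : 0 < C) (hx : 0 ≤ x)
    (h : ∀ n : ℕ, C * (n : ℝ) ^ (1 / q) ≤ x → e ≤ (2 : ℝ) ^ (-(n : ℝ))) :
    e ≤ 2 * ((2 : ℝ) ^ (-(C ^ (-q)))) ^ (x ^ q) := by
  have hdiv : 0 ≤ x / C := by positivity
  have hfloor := Nat.floor_le (Real.rpow_nonneg hdiv q)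
  refine (h ⌊(x / C) ^ q⌋₊ ?_).trans ?_
  · rw [mul_comm, ← le_div_iff₀ hC, one_div]
    exact (Real.rpow_inv_le_iff_of_pos (Nat.cast_nonneg _) hdiv hq).2 hfloor
  · have heq : C ^ (-q) * x ^ q = (x / C) ^ q := by
      rw [Real.div_rpow hx hC.le, Real.rpow_neg hC.le]
      ring
    rw [← Real.rpow_mul zero_le_two, neg_mul, heq]
    calc (2 : ℝ) ^ (-(⌊(x / C) ^ q⌋₊ : ℝ)) ≤ (2 : ℝ) ^ (1 + -(x / C) ^ q) := by
          refine Real.rpow_le_rpow_of_exponent_le one_le_two ?_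
          linarith [Nat.lt_floor_add_one ((x / C) ^ q)]
      _ = 2 * (2 : ℝ) ^ (-(x / C) ^ q) := by
          rw [Real.rpow_add two_pos, Real.rpow_one]

/-- Proposition 4(b).
(i) For reals `0 < q ≤ 1`, `0 < r < 1`, `B ≥ 1` and naturals `n ≥ 1` and
`m ≥ ((n + log₂ B)/log₂(1/r))^(1/q)` one has `B·r^(m^q) ≤ 2^(−n)`; in particular this
holds for all `m ≥ C·n^(1/q)` where `C = ((1 + log₂ B)/log₂(1/r))^(1/q)`.
(ii) Conversely, for reals `0 < q < 1 ≤ C` and a sequence `ε` with `ε_m ≤ 2^(−n)`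
whenever `m ≥ C·n^(1/q)`, setting `r = 2^(−C^(−q))` one has `1/2 ≤ r < 1` and
`ε_m ≤ 2·r^(m^q)` for every `m`. -/
theorem stmt_1 :
    (∀ q r B : ℝ, 0 < q → q ≤ 1 → 0 < r → r < 1 → 1 ≤ B →
      ∀ n m : ℕ, 1 ≤ n →
        (((((n : ℝ) + Real.logb 2 B) / Real.logb 2 (1 / r)) ^ (1 / q) ≤ (m : ℝ) →
          B * r ^ ((m : ℝ) ^ q) ≤ (2 : ℝ) ^ (-(n : ℝ))) ∧
        (((1 + Real.logb 2 B) / Real.logb 2 (1 / r)) ^ (1 / q) * (n : ℝ) ^ (1 / q) ≤ (m : ℝ) →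
          B * r ^ ((m : ℝ) ^ q) ≤ (2 : ℝ) ^ (-(n : ℝ))))) ∧
    (∀ q C : ℝ, 0 < q → q < 1 → 1 ≤ C → ∀ ε : ℕ → ℝ,
      (∀ n m : ℕ, C * (n : ℝ) ^ (1 / q) ≤ (m : ℝ) → ε m ≤ (2 : ℝ) ^ (-(n : ℝ))) →
      1 / 2 ≤ (2 : ℝ) ^ (-(C ^ (-q))) ∧ (2 : ℝ) ^ (-(C ^ (-q))) < 1 ∧
        ∀ m : ℕ, ε m ≤ 2 * ((2 : ℝ) ^ (-(C ^ (-q)))) ^ ((m : ℝ) ^ q)) := by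
  refine ⟨fun q r B hq _ hr0 hr1 hB n m hn => ?_, fun q C hq _ hC ε hε => ⟨?_, ?_, fun m => ?_⟩⟩
  · have hn' : (1 : ℝ) ≤ n := by exact_mod_cast hn
    have hL : 0 ≤ Real.logb 2 B := Real.logb_nonneg one_lt_two hB
    have hlog : 0 < Real.logb 2 (1 / r) :=
      Real.logb_pos one_lt_two ((one_lt_div hr0).2 hr1)
    have threshold : ((n : ℝ) + Real.logb 2 B) / Real.logb 2 (1 / r) ≤
        (1 + Real.logb 2 B) / Real.logb 2 (1 / r) * n := by
      rw [div_mul_eq_mul_div]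
      gcongr
      nlinarith
    have main (h : (((n : ℝ) + Real.logb 2 B) / Real.logb 2 (1 / r)) ^ (1 / q) ≤ (m : ℝ)) :
        B * r ^ ((m : ℝ) ^ q) ≤ (2 : ℝ) ^ (-(n : ℝ)) := by
      rw [one_div q, Real.rpow_inv_le_iff_of_pos (by positivity) m.cast_nonneg hq] at h
      exact mul_rpow_le_two_rpow_neg hr0 hr1 (by linarith) h
    refine ⟨main, fun h => main (le_trans ?_ h)⟩
    rw [← Real.mul_rpow (by positivity) n.cast_nonneg]
    exact Real.rpow_le_rpow (by positivity) threshold (by positivity)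
  · have hle : C ^ (-q) ≤ 1 := Real.rpow_le_one_of_one_le_of_nonpos hC (by linarith)
    calc (1 / 2 : ℝ) = (2 : ℝ) ^ (-1 : ℝ) := by rw [Real.rpow_neg_one, one_div]
      _ ≤ (2 : ℝ) ^ (-(C ^ (-q))) :=
          Real.rpow_le_rpow_of_exponent_le one_le_two (by linarith)
  · exact Real.rpow_lt_one_of_one_lt_of_neg one_lt_two
      (neg_neg_of_pos (Real.rpow_pos_of_pos (by linarith) _))
  · exact le_two_mul_rpow_of_le_two_rpow_neg hq (by linarith) m.cast_nonneg fun n => hε n m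
end

section
/- Let ℓ, A, K be real numbers with ℓ, A, K ≥ 1 and let f : ℝ → ℝ be infinitely differentiable and satisfy the Gevrey bound with parameters (ℓ, A, K) on [−1,1]. Set q := 1/ℓ, r := 2^(−(2πK)^(−q)) and B := A·(2+πK). Then for every natural number m ≥ 1 there exists a polynomial g_m with real coefficients of degree < m such that sup_{x∈[−1,1]} |f(x) − g_m(x)| ≤ B·r^(m^q). -/
open Finset in
theorem integral_sum_mul_sum_of_orthogonal (s : Finset ℕ) (b c : ℕ → ℝ) (φ : ℕ → ℝ → ℝ)
    (a d v : ℝ) (hφ : ∀ k, Continuous (φ k))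
    (horth : ∀ i ∈ s, ∀ j ∈ s, ∫ t in a..d, φ i t * φ j t = if i = j then v else 0) :
    ∫ t in a..d, (∑ k ∈ s, b k * φ k t) * (∑ k ∈ s, c k * φ k t) = v * ∑ k ∈ s, b k * c k := by
  have hterm : ∀ i j, IntervalIntegrable (fun t => b i * c j * (φ i t * φ j t))
      MeasureTheory.volume a d := fun i j =>
    (continuous_const.mul ((hφ i).mul (hφ j))).intervalIntegrable _ _
  have hexp : ∀ t, (∑ k ∈ s, b k * φ k t) * (∑ k ∈ s, c k * φ k t)
      = ∑ i ∈ s, ∑ j ∈ s, b i * c j * (φ i t * φ j t) := by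
    intro t
    rw [sum_mul_sum]
    exact sum_congr rfl fun i _ => sum_congr rfl fun j _ => by ring
  simp_rw [hexp]
  have hrow : ∀ i ∈ s, IntervalIntegrable (fun t => ∑ j ∈ s, b i * c j * (φ i t * φ j t))
      MeasureTheory.volume a d := fun i _ =>
    (continuous_finsetSum _ fun j _ =>
      continuous_const.mul ((hφ i).mul (hφ j))).intervalIntegrable _ _
  rw [intervalIntegral.integral_finsetSum hrow, mul_sum]
  refine sum_congr rfl fun i hi => ?_
  rw [intervalIntegral.integral_finsetSum fun j _ => hterm i j]
  rw [sum_eq_single_of_mem i hi]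
  · rw [intervalIntegral.integral_const_mul, horth i hi i hi, if_pos rfl]
    ring
  · intro j hj hji
    rw [intervalIntegral.integral_const_mul, horth i hi j hj, if_neg (Ne.symm hji), mul_zero]

theorem integral_cos_int_mul {n : ℤ} (hn : n ≠ 0) :
    ∫ t in (0 : ℝ)..Real.pi, Real.cos (n * t) = 0 := by
  have hn' : (n : ℝ) ≠ 0 := by exact_mod_cast hn
  rw [intervalIntegral.integral_comp_mul_left (fun t => Real.cos t) hn', integral_cos]
  simp [Real.sin_int_mul_pi]

theorem integral_sin_mul_sin_nat (i j : ℕ) (hi : i ≠ 0) :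
    ∫ t in (0 : ℝ)..Real.pi, Real.sin (i * t) * Real.sin (j * t)
      = if i = j then Real.pi / 2 else 0 := by
  have h : ∀ t : ℝ, Real.sin (i * t) * Real.sin (j * t)
      = (Real.cos (((i - j : ℤ) : ℝ) * t) - Real.cos (((i + j : ℤ) : ℝ) * t)) / 2 := by
    intro t
    push_cast
    rw [sub_mul, add_mul, Real.cos_sub, Real.cos_add]
    ring
  simp_rw [h]
  rw [intervalIntegral.integral_div, intervalIntegral.integral_sub
    ((by fun_prop : Continuous _).intervalIntegrable _ _)
    ((by fun_prop : Continuous _).intervalIntegrable _ _),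
    integral_cos_int_mul (n := i + j) (by omega)]
  split_ifs with hij
  · simp [hij]
  · rw [integral_cos_int_mul (by omega)]
    simp

theorem integral_cos_mul_cos_half (i j : ℕ) :
    ∫ t in (0 : ℝ)..Real.pi, Real.cos ((i + 1 / 2) * t) * Real.cos ((j + 1 / 2) * t)
      = if i = j then Real.pi / 2 else 0 := by
  have h : ∀ t : ℝ, Real.cos ((i + 1 / 2) * t) * Real.cos ((j + 1 / 2) * t)
      = (Real.cos (((i - j : ℤ) : ℝ) * t) + Real.cos (((i + j + 1 : ℤ) : ℝ) * t)) / 2 := by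
    intro t
    have h1 : ((i - j : ℤ) : ℝ) * t = (i + 1 / 2) * t - (j + 1 / 2) * t := by push_cast; ring
    have h2 : ((i + j + 1 : ℤ) : ℝ) * t = (i + 1 / 2) * t + (j + 1 / 2) * t := by push_cast; ring
    rw [h1, h2, Real.cos_sub, Real.cos_add]
    ring
  simp_rw [h]
  rw [intervalIntegral.integral_div, intervalIntegral.integral_add
    ((by fun_prop : Continuous _).intervalIntegrable _ _)
    ((by fun_prop : Continuous _).intervalIntegrable _ _),
    integral_cos_int_mul (n := i + j + 1) (by omega)]
  split_ifs with hij
  · simp [hij]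
  · rw [integral_cos_int_mul (by omega)]
    simp

/-- Coefficients whose sine series approximates `∑ sin (k t) / k` for frequencies in `[N, L]`. -/
noncomputable def jacksonCoeff (N L k : ℕ) : ℝ :=
  if k < N then k / (N : ℝ) ^ 2 else if k ≤ L then 1 / (k : ℝ) else 0

open Finset in
theorem sum_sq_jacksonCoeff_le {N L : ℕ} (hN : 0 < N) (hL : N ≤ L) :
    ∑ k ∈ range (L + 1), jacksonCoeff N L k ^ 2 ≤ 2 / N := by
  have hNR : (1 : ℝ) ≤ N := by exact_mod_cast hN
  have h1 : ∀ n : ℕ, n ≤ N → ∑ k ∈ range n, jacksonCoeff N L k ^ 2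
      = (n * (n - 1) * (2 * n - 1) / 6) / (N : ℝ) ^ 4 := by
    intro n
    induction n with
    | zero => simp
    | succ n ih =>
      intro hn
      rw [sum_range_succ, ih (by omega), jacksonCoeff, if_pos (by omega)]
      push_cast
      field_simp
      ring
  have h2 : ∀ n : ℕ, N ≤ n → n ≤ L → ∑ k ∈ range (n + 1), jacksonCoeff N L k ^ 2
      ≤ (N * (N - 1) * (2 * N - 1) / 6) / (N : ℝ) ^ 4 + 1 / N ^ 2 + 1 / N - 1 / n := by
    intro n hn
    induction n, hn using Nat.le_induction with
    | base =>
      intro hn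
      rw [sum_range_succ, h1 N le_rfl, jacksonCoeff, if_neg (by omega), if_pos hn, div_pow]
      simp
    | succ n hn ih =>
      intro hnL
      have hnR : (1 : ℝ) ≤ n := by exact_mod_cast hN.trans_le hn
      rw [sum_range_succ, jacksonCoeff, if_neg (by omega), if_pos hnL]
      have h3 : (1 / ((n + 1 : ℕ) : ℝ)) ^ 2 ≤ 1 / n - 1 / ((n + 1 : ℕ) : ℝ) := by
        push_cast
        rw [div_sub_div _ _ (by positivity) (by positivity), div_pow,
          div_le_div_iff₀ (by positivity) (by positivity)]
        nlinarith
      linarith [ih (by omega)]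
  refine (h2 L hL le_rfl).trans ?_
  have h4 : (0 : ℝ) ≤ 1 / L := by positivity
  have h5 : ((N : ℝ) * (N - 1) * (2 * N - 1) / 6) / (N : ℝ) ^ 4 + 1 / N ^ 2 + 1 / N ≤ 2 / N := by
    rw [← sub_nonneg]
    have : 2 / (N : ℝ) - (((N : ℝ) * (N - 1) * (2 * N - 1) / 6) / (N : ℝ) ^ 4 + 1 / N ^ 2 + 1 / N)
        = (N - 1) * (4 * N + 1) / (6 * N ^ 3) := by
      field_simp
      ring
    rw [this]
    have : (0 : ℝ) ≤ N - 1 := by linarith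
    positivity
  linarith

open Finset in
theorem sum_sq_jacksonCoeff_sub_le {N L : ℕ} (hN : 0 < N) (hL : N ^ 2 ≤ L) :
    ∑ k ∈ range (L + 1), (jacksonCoeff N L (k + 1) - jacksonCoeff N L k) ^ 2
      ≤ 2 / (N : ℝ) ^ 3 := by
  have hNL : N ≤ L := (Nat.le_self_pow two_ne_zero N).trans hL
  have hNR : (1 : ℝ) ≤ N := by exact_mod_cast hN
  have h1 : ∀ n : ℕ, n ≤ N →
      ∑ k ∈ range n, (jacksonCoeff N L (k + 1) - jacksonCoeff N L k) ^ 2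
      = n / (N : ℝ) ^ 4 := by
    intro n
    induction n with
    | zero => simp
    | succ n ih =>
      intro hn
      have h2 : jacksonCoeff N L (n + 1) = ((n : ℝ) + 1) / N ^ 2 := by
        rw [jacksonCoeff]
        rcases hn.lt_or_eq with h | h
        · rw [if_pos h]
          push_cast
          rfl
        · rw [if_neg (by omega), if_pos (by omega), ← h]
          push_cast
          field_simp
      rw [sum_range_succ, ih (by omega), h2, jacksonCoeff, if_pos (by omega)]
      push_cast
      field_simp
      ring
  have h2 : ∀ n : ℕ, N ≤ n → n ≤ L →
      ∑ k ∈ range n, (jacksonCoeff N L (k + 1) - jacksonCoeff N L k) ^ 2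
      ≤ 1 / (N : ℝ) ^ 3 + 1 / N ^ 2 * (1 / N - 1 / n) := by
    intro n hn
    induction n, hn using Nat.le_induction with
    | base =>
      intro hn
      rw [h1 N le_rfl, sub_self, mul_zero, add_zero]
      apply le_of_eq
      field_simp
    | succ n hn ih =>
      intro hnL
      have hnN : (N : ℝ) ≤ n := by exact_mod_cast hn
      have hnR : (1 : ℝ) ≤ n := hNR.trans hnN
      rw [sum_range_succ, jacksonCoeff, if_neg (by omega), if_pos hnL, jacksonCoeff,
        if_neg (by omega), if_pos (by omega)]
      have h3 : (1 / ((n + 1 : ℕ) : ℝ) - 1 / n) ^ 2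
          ≤ 1 / N ^ 2 * (1 / n - 1 / ((n + 1 : ℕ) : ℝ)) := by
        push_cast
        have e1 : 1 / (n : ℝ) - 1 / (n + 1) = 1 / (n * (n + 1)) := by
          field_simp
          ring
        have e2 : (1 / ((n : ℝ) + 1) - 1 / n) ^ 2 = (1 / (n * (n + 1))) * (1 / (n * (n + 1))) := by
          rw [← e1]
          ring
        rw [e2, e1]
        refine mul_le_mul_of_nonneg_right (one_div_le_one_div_of_le (by positivity) ?_)
          (by positivity)
        nlinarith
      have h4 := ih (by omega)
      linarith [h4, h3, mul_sub (1 / (N : ℝ) ^ 2) (1 / (N : ℝ)) (1 / n),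
        mul_sub (1 / (N : ℝ) ^ 2) (1 / (N : ℝ)) (1 / ((n + 1 : ℕ) : ℝ)),
        mul_sub (1 / (N : ℝ) ^ 2) (1 / (n : ℝ)) (1 / ((n + 1 : ℕ) : ℝ))]
  rw [sum_range_succ, jacksonCoeff, if_neg (by omega), if_neg (by omega), jacksonCoeff,
    if_neg (by omega), if_pos le_rfl]
  have hLR : (N : ℝ) ^ 2 ≤ L := by exact_mod_cast hL
  have hL0 : (0 : ℝ) < L := by nlinarith
  have h5 : (0 - 1 / (L : ℝ)) ^ 2 ≤ 1 / N ^ 2 * (1 / L) := by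
    have : (0 - 1 / (L : ℝ)) ^ 2 = 1 / L * (1 / L) := by ring
    rw [this]
    exact mul_le_mul_of_nonneg_right (one_div_le_one_div_of_le (by positivity) hLR) (by positivity)
  have h6 : 2 / (N : ℝ) ^ 3 = 1 / N ^ 3 + 1 / N ^ 2 * (1 / N) := by
    field_simp
    norm_num
  linarith [h2 L hNL le_rfl, mul_sub (1 / (N : ℝ) ^ 2) (1 / (N : ℝ)) (1 / L)]

/-- The sine polynomial with coefficients `jacksonCoeff`. -/
noncomputable def jacksonKernel (N L : ℕ) (t : ℝ) : ℝ :=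
  ∑ k ∈ Finset.range (L + 1), jacksonCoeff N L k * Real.sin (k * t)

theorem continuous_jacksonKernel (N L : ℕ) : Continuous (jacksonKernel N L) := by
  unfold jacksonKernel
  fun_prop

theorem jacksonCoeff_zero {N : ℕ} (hN : 0 < N) (L : ℕ) : jacksonCoeff N L 0 = 0 := by
  simp [jacksonCoeff, hN]

open Finset in
theorem two_sin_half_mul_jacksonKernel {N : ℕ} (hN : 0 < N) (L : ℕ) (hL : N ≤ L) (t : ℝ) :
    2 * Real.sin (t / 2) * jacksonKernel N L t
      = ∑ k ∈ range (L + 1), (jacksonCoeff N L (k + 1) - jacksonCoeff N L k)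
          * Real.cos ((k + 1 / 2) * t) := by
  have h : ∀ n : ℕ, 2 * Real.sin (t / 2) * ∑ k ∈ range (n + 1), jacksonCoeff N L k
        * Real.sin (k * t)
      = ∑ k ∈ range (n + 1), (jacksonCoeff N L (k + 1) - jacksonCoeff N L k)
          * Real.cos ((k + 1 / 2) * t) - jacksonCoeff N L (n + 1) * Real.cos ((n + 1 / 2) * t) := by
    intro n
    induction n with
    | zero => simp [jacksonCoeff_zero hN]
    | succ n ih =>
      rw [sum_range_succ, mul_add, ih, sum_range_succ _ (n + 1)]
      have e1 : ((n : ℝ) + 1 / 2) * t = ((n + 1 : ℕ) : ℝ) * t - t / 2 := by push_cast; ring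
      have e2 : (((n + 1 : ℕ) : ℝ) + 1 / 2) * t = ((n + 1 : ℕ) : ℝ) * t + t / 2 := by ring
      rw [e1, e2, Real.cos_sub, Real.cos_add]
      ring
  rw [jacksonKernel, h, jacksonCoeff, if_neg (by omega), if_neg (by omega)]
  ring

theorem integral_jacksonKernel_sq_le {N L : ℕ} (hN : 0 < N) (hL : N ≤ L) :
    ∫ t in (0 : ℝ)..Real.pi, jacksonKernel N L t ^ 2 ≤ Real.pi / N := by
  have h := integral_sum_mul_sum_of_orthogonal (Finset.Ico 1 (L + 1)) (jacksonCoeff N L)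
    (jacksonCoeff N L) (fun k t => Real.sin (k * t)) 0 Real.pi (Real.pi / 2)
    (fun k => by fun_prop) (fun i hi j _ => integral_sin_mul_sin_nat i j
      (by have := (Finset.mem_Ico.1 hi).1; omega))
  have hs : ∀ g : ℕ → ℝ, g 0 = 0 →
      ∑ k ∈ Finset.Ico 1 (L + 1), g k = ∑ k ∈ Finset.range (L + 1), g k := by
    intro g hg
    rw [Finset.range_eq_Ico, Finset.sum_eq_sum_Ico_succ_bot (Nat.succ_pos L), hg, zero_add]
  simp only [pow_two, jacksonKernel]
  rw [hs _ (by simp [jacksonCoeff_zero hN])] at h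
  simp_rw [hs (fun k => jacksonCoeff N L k * Real.sin (k * _)) (by simp)] at h
  rw [h]
  have h2 := sum_sq_jacksonCoeff_le hN hL
  simp only [pow_two] at h2
  calc _ ≤ Real.pi / 2 * (2 / N) := by gcongr
    _ = _ := by ring

theorem integral_two_sin_half_mul_jacksonKernel_sq_le {N L : ℕ} (hN : 0 < N) (hL : N ^ 2 ≤ L) :
    ∫ t in (0 : ℝ)..Real.pi, (2 * Real.sin (t / 2) * jacksonKernel N L t) ^ 2
      ≤ Real.pi / (N : ℝ) ^ 3 := by
  have hNL : N ≤ L := (Nat.le_self_pow two_ne_zero N).trans hL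
  simp_rw [two_sin_half_mul_jacksonKernel hN L hNL, pow_two]
  rw [integral_sum_mul_sum_of_orthogonal _ _ _ (fun k t => Real.cos ((k + 1 / 2) * t)) 0 Real.pi
    (Real.pi / 2) (fun k => by fun_prop) (fun i _ j _ => integral_cos_mul_cos_half i j)]
  have h2 := sum_sq_jacksonCoeff_sub_le hN hL
  simp only [pow_two] at h2
  calc _ ≤ Real.pi / 2 * (2 / (N : ℝ) ^ 3) := by gcongr
    _ = _ := by ring

theorem integral_inv_one_add_sq_le {N : ℕ} (hN : 0 < N) :
    ∫ t in (0 : ℝ)..Real.pi, (1 + (2 * N / Real.pi * t) ^ 2)⁻¹ ≤ Real.pi ^ 2 / (4 * N) := by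
  have hπ := Real.pi_pos
  have hNR : (0 : ℝ) < N := by exact_mod_cast hN
  rw [intervalIntegral.integral_comp_mul_left (fun x => (1 + x ^ 2)⁻¹) (by positivity),
    integral_inv_one_add_sq, mul_zero, Real.arctan_zero, sub_zero, smul_eq_mul]
  calc _ ≤ (2 * N / Real.pi)⁻¹ * (Real.pi / 2) := by
        gcongr
        exact (Real.arctan_lt_pi_div_two _).le
    _ = _ := by field_simp; norm_num

theorem integral_abs_jacksonKernel_le {N L : ℕ} (hN : 0 < N) (hL : N ^ 2 ≤ L) :
    ∫ t in (0 : ℝ)..Real.pi, |jacksonKernel N L t|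
      ≤ (5 / 8 * Real.pi + Real.pi ^ 2 / 5) / N := by
  have hπ := Real.pi_pos
  have hNR : (0 : ℝ) < N := by exact_mod_cast hN
  have hc := continuous_jacksonKernel N L
  have hpt : ∀ t ∈ Set.Icc (0 : ℝ) Real.pi, |jacksonKernel N L t| ≤
      5 / 16 * jacksonKernel N L t ^ 2
      + 5 / 16 * (N : ℝ) ^ 2 * (2 * Real.sin (t / 2) * jacksonKernel N L t) ^ 2
      + 4 / 5 * (1 + (2 * N / Real.pi * t) ^ 2)⁻¹ := by
    intro t ht
    set h := jacksonKernel N L t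
    set w := 1 + (2 * N / Real.pi * t) ^ 2
    have hw : 0 < w := by positivity
    have hsin : 2 / Real.pi * (t / 2) ≤ Real.sin (t / 2) :=
      Real.mul_le_sin (by linarith [ht.1]) (by linarith [ht.2])
    have hle : w ≤ 1 + (N : ℝ) ^ 2 * (2 * Real.sin (t / 2)) ^ 2 := by
      have h0 : 0 ≤ 2 / Real.pi * (t / 2) := mul_nonneg (by positivity) (by linarith [ht.1])
      have : (2 / Real.pi * (t / 2)) ^ 2 ≤ Real.sin (t / 2) ^ 2 := by gcongr
      have e : w = 1 + (N : ℝ) ^ 2 * (4 * (2 / Real.pi * (t / 2)) ^ 2) := by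
        simp only [w]; ring
      have e2 : (2 * Real.sin (t / 2)) ^ 2 = 4 * Real.sin (t / 2) ^ 2 := by ring
      rw [e, e2]
      gcongr
    have hag : |h| ≤ 5 / 16 * (w * h ^ 2) + 4 / 5 * w⁻¹ := by
      have h1 : 0 ≤ w⁻¹ * (5 * (w * |h|) - 8) ^ 2 := by positivity
      have h2 : w⁻¹ * (5 * (w * |h|) - 8) ^ 2 = 25 * (w * |h| ^ 2) - 80 * |h| + 64 * w⁻¹ := by
        field_simp
        ring
      rw [h2, sq_abs] at h1
      linarith
    have := mul_le_mul_of_nonneg_right hle (sq_nonneg h)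
    nlinarith
  have hwc : Continuous fun t : ℝ => (1 + (2 * N / Real.pi * t) ^ 2)⁻¹ :=
    Continuous.inv₀ (by fun_prop) fun t => by positivity
  calc ∫ t in (0 : ℝ)..Real.pi, |jacksonKernel N L t|
      ≤ ∫ t in (0 : ℝ)..Real.pi, (5 / 16 * jacksonKernel N L t ^ 2
        + 5 / 16 * (N : ℝ) ^ 2 * (2 * Real.sin (t / 2) * jacksonKernel N L t) ^ 2
        + 4 / 5 * (1 + (2 * N / Real.pi * t) ^ 2)⁻¹) := by
        refine intervalIntegral.integral_mono_on hπ.le ?_ ?_ hpt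
        · exact hc.abs.intervalIntegrable _ _
        · exact Continuous.intervalIntegrable (by fun_prop) _ _
    _ = 5 / 16 * (∫ t in (0 : ℝ)..Real.pi, jacksonKernel N L t ^ 2)
        + 5 / 16 * (N : ℝ) ^ 2 *
          (∫ t in (0 : ℝ)..Real.pi, (2 * Real.sin (t / 2) * jacksonKernel N L t) ^ 2)
        + 4 / 5 * ∫ t in (0 : ℝ)..Real.pi, (1 + (2 * N / Real.pi * t) ^ 2)⁻¹ := by
        rw [intervalIntegral.integral_add, intervalIntegral.integral_add,
          intervalIntegral.integral_const_mul, intervalIntegral.integral_const_mul,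
          intervalIntegral.integral_const_mul]
        all_goals exact Continuous.intervalIntegrable (by fun_prop) _ _
    _ ≤ 5 / 16 * (Real.pi / N) + 5 / 16 * (N : ℝ) ^ 2 * (Real.pi / (N : ℝ) ^ 3)
        + 4 / 5 * (Real.pi ^ 2 / (4 * N)) := by
        have hNL : N ≤ L := (Nat.le_self_pow two_ne_zero N).trans hL
        gcongr
        · exact integral_jacksonKernel_sq_le hN hNL
        · exact integral_two_sin_half_mul_jacksonKernel_sq_le hN hL
        · exact integral_inv_one_add_sq_le hN
    _ = _ := by
        field_simp
        ring

open Polynomial Finset in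
theorem exists_eq_sum_chebyshev (p : ℝ[X]) :
    ∃ (n : ℕ) (a : ℕ → ℝ), ∀ L, n ≤ L →
      p = ∑ k ∈ range (L + 1), C (a k) * Chebyshev.T ℝ k := by
  let S : Polynomial.Sequence ℝ :=
    ⟨fun k => Chebyshev.T ℝ k, fun k => by simp [Chebyshev.degree_T]⟩
  have hS : p ∈ Submodule.span ℝ (Set.range S) := by
    rw [S.span fun i => (leadingCoeff_ne_zero.2 (S.ne_zero i)).isUnit]
    trivial
  obtain ⟨a, ha⟩ := Finsupp.mem_span_range_iff_exists_finsupp.1 hS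
  refine ⟨a.support.sup id, a, fun L hL => ?_⟩
  rw [← ha, Finsupp.sum_of_support_subset a (s := range (L + 1))]
  · exact sum_congr rfl fun k _ => by rw [smul_eq_C_mul]
  · intro k hk
    rw [mem_range, Nat.lt_succ_iff]
    exact (le_sup (f := id) hk).trans hL
  · simp

open Polynomial Finset in
/-- Jackson's inequality for polynomials. -/
theorem Polynomial.exists_natDegree_lt_abs_sub_le (p : ℝ[X]) {M : ℝ}
    (hp : ∀ x ∈ Set.Icc (-1 : ℝ) 1, |p.derivative.eval x| ≤ M) {N : ℕ} (hN : 0 < N) :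
    ∃ g : ℝ[X], g.natDegree < N ∧ ∀ x ∈ Set.Icc (-1 : ℝ) 1,
      |p.eval x - g.eval x| ≤ (5 / 4 + 2 / 5 * Real.pi) * M / N := by
  have hπ := Real.pi_pos
  have hM : 0 ≤ M := (abs_nonneg _).trans (hp 0 (by norm_num))
  have hNR : (0 : ℝ) < N := by exact_mod_cast hN
  obtain ⟨n, a, ha⟩ := exists_eq_sum_chebyshev p
  obtain ⟨L, hnL, hNL⟩ : ∃ L, n ≤ L ∧ N ^ 2 ≤ L := ⟨max n (N ^ 2), by simp, by simp⟩
  have hNL' : N ≤ L := (Nat.le_self_pow two_ne_zero N).trans hNL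
  specialize ha L hnL
  have hcos : ∀ φ : ℝ, p.eval (Real.cos φ) = ∑ k ∈ range (L + 1), a k * Real.cos (k * φ) := by
    intro φ
    conv_lhs => rw [ha]
    simp [eval_finsetSum, Chebyshev.T_real_cos]
  have hder : ∀ φ : ℝ, ∑ k ∈ range (L + 1), a k * (k * Real.sin (k * φ))
      = Real.sin φ * p.derivative.eval (Real.cos φ) := by
    intro φ
    have h1 : HasDerivAt (fun φ => p.eval (Real.cos φ))
        (p.derivative.eval (Real.cos φ) * -Real.sin φ) φ :=
      (p.hasDerivAt _).comp φ (Real.hasDerivAt_cos φ)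
    have h2 : HasDerivAt (fun φ => ∑ k ∈ range (L + 1), a k * Real.cos (k * φ))
        (∑ k ∈ range (L + 1), a k * (-Real.sin (k * φ) * k)) φ := by
      refine HasDerivAt.fun_sum fun k _ => ?_
      have h3 : HasDerivAt (fun φ : ℝ => (k : ℝ) * φ) k φ := by
        simpa using (hasDerivAt_id φ).const_mul (k : ℝ)
      exact ((Real.hasDerivAt_cos _).comp φ h3).const_mul _
    simp_rw [← hcos] at h2
    have h4 := h1.unique h2
    have h5 : ∑ k ∈ range (L + 1), a k * (-Real.sin (k * φ) * k)
        = -∑ k ∈ range (L + 1), a k * (k * Real.sin (k * φ)) := by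
      rw [← sum_neg_distrib]
      exact sum_congr rfl fun k _ => by ring
    linarith
  have hbd : ∀ φ : ℝ, |∑ k ∈ range (L + 1), a k * (k * Real.sin (k * φ))| ≤ M := by
    intro φ
    rw [hder, abs_mul]
    calc _ ≤ 1 * M := mul_le_mul (Real.abs_sin_le_one φ) (hp _ (Real.cos_mem_Icc φ))
          (abs_nonneg _) zero_le_one
      _ = M := one_mul M
  have hG : ∀ θ t : ℝ, |∑ k ∈ range (L + 1), (k * a k * Real.cos (k * θ)) * Real.sin (k * t)|
      ≤ M := by
    intro θ t
    have h1 : ∑ k ∈ range (L + 1), (k * a k * Real.cos (k * θ)) * Real.sin (k * t)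
        = (∑ k ∈ range (L + 1), a k * (k * Real.sin (k * (θ + t)))
          - ∑ k ∈ range (L + 1), a k * (k * Real.sin (k * (θ - t)))) / 2 := by
      rw [← sum_sub_distrib, sum_div]
      refine sum_congr rfl fun k _ => ?_
      rw [mul_add, mul_sub, Real.sin_add, Real.sin_sub]
      ring
    rw [h1, abs_le]
    have h2 := abs_le.1 (hbd (θ + t))
    have h3 := abs_le.1 (hbd (θ - t))
    constructor <;> linarith
  have hR : ∀ θ : ℝ, |∑ k ∈ range (L + 1), k * jacksonCoeff N L k * a k * Real.cos (k * θ)|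
      ≤ (5 / 4 + 2 / 5 * Real.pi) * M / N := by
    intro θ
    have hs : ∀ g : ℕ → ℝ, g 0 = 0 → ∑ k ∈ Ico 1 (L + 1), g k = ∑ k ∈ range (L + 1), g k := by
      intro g hg
      rw [range_eq_Ico, sum_eq_sum_Ico_succ_bot (Nat.succ_pos L), hg, zero_add]
    have h := integral_sum_mul_sum_of_orthogonal (Ico 1 (L + 1))
      (fun k => k * a k * Real.cos (k * θ)) (jacksonCoeff N L)
      (fun k t => Real.sin (k * t)) 0 Real.pi (Real.pi / 2)
      (fun k => by fun_prop) (fun i hi j _ => integral_sin_mul_sin_nat i j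
        (by have := (mem_Ico.1 hi).1; omega))
    rw [hs _ (by simp)] at h
    simp_rw [hs (fun k => jacksonCoeff N L k * Real.sin (k * _)) (by simp),
      hs (fun k => k * a k * Real.cos (k * θ) * Real.sin (k * _)) (by simp)] at h
    have hI : |∫ t in (0 : ℝ)..Real.pi,
        (∑ k ∈ range (L + 1), k * a k * Real.cos (k * θ) * Real.sin (k * t))
          * jacksonKernel N L t| ≤ M * ((5 / 8 * Real.pi + Real.pi ^ 2 / 5) / N) := by
      refine (intervalIntegral.abs_integral_le_integral_abs hπ.le).trans ?_
      have hc := continuous_jacksonKernel N L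
      calc _ ≤ ∫ t in (0 : ℝ)..Real.pi, M * |jacksonKernel N L t| := by
            refine intervalIntegral.integral_mono_on hπ.le
              (Continuous.intervalIntegrable (by fun_prop) _ _)
              (Continuous.intervalIntegrable (by fun_prop) _ _) fun t _ => ?_
            rw [abs_mul]
            gcongr
            exact hG θ t
        _ ≤ _ := by
            rw [intervalIntegral.integral_const_mul]
            gcongr
            exact integral_abs_jacksonKernel_le hN hNL
    have hsum : ∑ k ∈ range (L + 1), k * jacksonCoeff N L k * a k * Real.cos (k * θ)
        = 2 / Real.pi * ∫ t in (0 : ℝ)..Real.pi,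
        (∑ k ∈ range (L + 1), k * a k * Real.cos (k * θ) * Real.sin (k * t))
          * jacksonKernel N L t := by
      simp only [jacksonKernel]
      rw [h, ← mul_assoc, show 2 / Real.pi * (Real.pi / 2) = 1 by field_simp, one_mul]
      exact sum_congr rfl fun k _ => by ring
    rw [hsum, abs_mul, abs_of_pos (by positivity)]
    calc _ ≤ 2 / Real.pi * (M * ((5 / 8 * Real.pi + Real.pi ^ 2 / 5) / N)) := by gcongr
      _ = _ := by
        field_simp
        ring
  refine ⟨∑ k ∈ range N, C (a k * (1 - k * jacksonCoeff N L k)) * Chebyshev.T ℝ k, ?_, ?_⟩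
  · refine (natDegree_sum_le_of_forall_le (n := N - 1) _ _ fun k hk => ?_).trans_lt (by omega)
    refine (natDegree_C_mul_le _ _).trans ?_
    rw [Chebyshev.natDegree_T]
    have := mem_range.1 hk
    simp only [Int.natAbs_natCast]
    omega
  · intro x hx
    rw [← Real.cos_arccos hx.1 hx.2]
    convert hR (Real.arccos x) using 2
    rw [hcos]
    have h1 : (∑ k ∈ range N, C (a k * (1 - k * jacksonCoeff N L k)) * Chebyshev.T ℝ k).eval
        (Real.cos (Real.arccos x))
        = ∑ k ∈ range N, a k * (1 - k * jacksonCoeff N L k) * Real.cos (k * Real.arccos x) := by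
      simp only [eval_finsetSum, eval_mul, eval_C, Chebyshev.T_real_cos]
      rfl
    rw [h1, sub_eq_iff_eq_add, sum_subset (range_subset_range.2 (by omega : N ≤ L + 1)),
      ← sum_add_distrib]
    · exact sum_congr rfl fun k _ => by ring
    · intro k hk hk'
      rw [mem_range] at hk hk'
      have hk0 : (k : ℝ) ≠ 0 := by
        norm_cast
        omega
      rw [jacksonCoeff, if_neg hk', if_pos (by omega), mul_one_div_cancel hk0]
      ring

open Polynomial in
theorem Polynomial.exists_derivative_eq (q : ℝ[X]) :
    ∃ P : ℝ[X], P.derivative = q ∧ P.natDegree ≤ q.natDegree + 1 := by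
  refine ⟨∑ n ∈ Finset.range (q.natDegree + 1), monomial (n + 1) (q.coeff n / (n + 1)), ?_, ?_⟩
  · conv_rhs => rw [q.as_sum_range]
    rw [derivative_sum]
    refine Finset.sum_congr rfl fun n _ => ?_
    rw [derivative_monomial]
    congr 1
    push_cast
    field_simp
  · refine natDegree_sum_le_of_forall_le _ _ fun n hn => (natDegree_monomial_le _).trans ?_
    have := Finset.mem_range.1 hn
    omega

open Polynomial in
/-- Jackson's inequality for continuously differentiable functions. -/
theorem exists_polynomial_abs_sub_le_of_abs_deriv_le {f : ℝ → ℝ} (hf : ContDiff ℝ 1 f) {M : ℝ}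
    (hM : 0 < M) (hfM : ∀ x ∈ Set.Icc (-1 : ℝ) 1, |deriv f x| ≤ M) {N : ℕ} (hN : 0 < N) :
    ∃ g : ℝ[X], g.natDegree < N ∧ ∀ x ∈ Set.Icc (-1 : ℝ) 1,
      |f x - g.eval x| ≤ 13 / 5 * M / N := by
  have hNR : (1 : ℝ) ≤ N := by exact_mod_cast hN
  set ε : ℝ := M / (100 * N) with hε
  have hε0 : 0 < ε := by positivity
  have hεM : ε ≤ M / 100 := div_le_div_of_nonneg_left hM.le (by norm_num) (by linarith)
  obtain ⟨q, hq⟩ := exists_polynomial_near_of_continuousOn (-1) 1 (deriv f)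
    (hf.continuous_deriv le_rfl).continuousOn ε hε0
  obtain ⟨P, hP, -⟩ := Polynomial.exists_derivative_eq q
  obtain ⟨g, hg, hgx⟩ := P.exists_natDegree_lt_abs_sub_le (M := M + ε) (fun x hx => by
    rw [hP]
    have h1 := abs_lt.1 (hq x hx)
    have h2 := abs_le.1 (hfM x hx)
    rw [abs_le]
    constructor <;> linarith) hN
  have hdiff : Differentiable ℝ f := hf.differentiable one_ne_zero
  refine ⟨g + C (f 0 - P.eval 0), by rwa [natDegree_add_C], fun x hx => ?_⟩
  have hmv := (convex_Icc (-1 : ℝ) 1).norm_image_sub_le_of_norm_deriv_le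
    (f := fun y => f y - P.eval y) (C := ε) (x := 0) (y := x)
    (fun y _ => (hdiff y).sub P.differentiableAt) (fun y hy => by
      rw [deriv_fun_sub (hdiff y) P.differentiableAt, Polynomial.deriv, hP, norm_sub_rev]
      exact (hq y hy).le) (by norm_num) hx
  simp only [Real.norm_eq_abs, sub_zero] at hmv
  have hx1 : |x| ≤ 1 := abs_le.2 hx
  have hmv' : |f x - P.eval x - (f 0 - P.eval 0)| ≤ ε :=
    hmv.trans (mul_le_of_le_one_right hε0.le hx1)
  have hb : (5 / 4 + 2 / 5 * Real.pi) * (M + ε) / N + ε ≤ 13 / 5 * M / N := by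
    have h1 : (5 / 4 + 2 / 5 * Real.pi) * (M + ε) ≤ (5 / 4 + 2 / 5 * 3.15) * (M + M / 100) := by
      gcongr
      exact Real.pi_lt_d2.le
    have h2 : ε = M / 100 / N := by rw [hε]; field_simp
    calc _ ≤ (5 / 4 + 2 / 5 * 3.15) * (M + M / 100) / N + M / 100 / N := by rw [← h2]; gcongr
      _ = ((5 / 4 + 2 / 5 * 3.15) * (M + M / 100) + M / 100) / N := by ring
      _ ≤ _ := by gcongr; linarith
  refine le_trans ?_ hb
  have h1 := abs_le.1 (hgx x hx)
  have h2 := abs_le.1 hmv'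
  rw [eval_add, eval_C, abs_le]
  constructor <;> linarith

open Polynomial in
/-- Jackson's inequality for derivatives of higher order. -/
theorem exists_polynomial_abs_sub_le_of_abs_iteratedDeriv_le (j : ℕ) {M : ℝ} (hM : 0 < M) :
    ∀ {f : ℝ → ℝ}, ContDiff ℝ (⊤ : ℕ∞) f →
      (∀ x ∈ Set.Icc (-1 : ℝ) 1, |iteratedDeriv j f x| ≤ M) → ∀ {N : ℕ}, j < N →
      ∃ g : ℝ[X], g.natDegree < N ∧ ∀ x ∈ Set.Icc (-1 : ℝ) 1,
        |f x - g.eval x| ≤ (13 / 5) ^ j * M / N.descFactorial j := by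
  induction j with
  | zero =>
    intro f _ hfM N hN
    exact ⟨0, by simpa using hN, by simpa using hfM⟩
  | succ j ih =>
    intro f hf hfM N hN
    obtain ⟨n, rfl⟩ : ∃ n, N = n + 1 := ⟨N - 1, by omega⟩
    have hf' : ContDiff ℝ (⊤ : ℕ∞) (deriv f) := (contDiff_infty_iff_deriv.1 hf).2
    obtain ⟨g₁, hg₁, hg₁x⟩ := ih hf' (fun x hx => by rw [← iteratedDeriv_succ']; exact hfM x hx)
      (N := n) (by omega)
    obtain ⟨P, hP, hPdeg⟩ := Polynomial.exists_derivative_eq g₁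
    have hdiff : Differentiable ℝ f := hf.differentiable (by simp)
    have hpos : 0 < (n.descFactorial j : ℝ) := by
      exact_mod_cast Nat.descFactorial_pos.2 (by omega)
    obtain ⟨g, hg, hgx⟩ := exists_polynomial_abs_sub_le_of_abs_deriv_le
      (f := fun x => f x - P.eval x)
      ((hf.of_le (by exact_mod_cast le_top)).sub (contDiff_aeval P _))
      (M := (13 / 5) ^ j * M / n.descFactorial j) (by positivity)
      (fun x hx => by
        rw [deriv_fun_sub (hdiff x) P.differentiableAt, Polynomial.deriv, hP]
        exact hg₁x x hx) hN.pos
    refine ⟨g + P, (natDegree_add_le _ _).trans_lt (max_lt hg (by omega)), fun x hx => ?_⟩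
    convert hgx x hx using 1
    · rw [eval_add]
      congr 1
      ring
    · rw [Nat.succ_descFactorial_succ]
      push_cast
      rw [pow_succ]
      field_simp

/-- Proposition 4(c): if `f` is smooth and satisfies the Gevrey bound
`|f^{(j)}(x)| ≤ A·K^j·j^(jℓ)` on `[−1,1]` with `ℓ, A, K ≥ 1`, then, setting
`q = 1/ℓ`, `r = 2^(−(2πK)^(−q))` and `B = A·(2+πK)`, for every `m ≥ 1` there is a
polynomial `g` of degree `< m` with `sup_{[−1,1]} |f − g| ≤ B·r^(m^q)`. -/
theorem stmt_2 (ℓ A K : ℝ) (hℓ : 1 ≤ ℓ) (hA : 1 ≤ A) (hK : 1 ≤ K)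
    (f : ℝ → ℝ) (hf : ContDiff ℝ (⊤ : ℕ∞) f)
    (hG : ∀ j : ℕ, ∀ x ∈ Set.Icc (-1 : ℝ) 1,
      |iteratedDeriv j f x| ≤ A * K ^ j * (j : ℝ) ^ ((j : ℝ) * ℓ))
    (q r B : ℝ) (hq : q = 1 / ℓ)
    (hr : r = (2 : ℝ) ^ (-(2 * Real.pi * K) ^ (-q)))
    (hB : B = A * (2 + Real.pi * K)) :
    ∀ m : ℕ, 1 ≤ m → ∃ g : Polynomial ℝ, g.natDegree < m ∧
      ∀ x ∈ Set.Icc (-1 : ℝ) 1, |f x - g.eval x| ≤ B * r ^ ((m : ℝ) ^ q) := by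
  intro m hm
  have hπ := Real.pi_pos
  have hπ3 := Real.pi_gt_d2
  have hmR : (1 : ℝ) ≤ m := by exact_mod_cast hm
  have hℓ0 : ℓ ≠ 0 := by positivity
  set y : ℝ := m / (2 * Real.pi * K) with hy
  have hy0 : 0 < y := by positivity
  set J : ℝ := y ^ q with hJ
  have hJ0 : 0 ≤ J := by positivity
  have hrJ : r ^ ((m : ℝ) ^ q) = 2 ^ (-J) := by
    rw [hr, ← Real.rpow_mul zero_le_two, hJ, hy, Real.div_rpow (by positivity) (by positivity),
      Real.rpow_neg (by positivity), div_eq_inv_mul, neg_mul]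
  have hym : y ≤ m / (2 * Real.pi) := by
    refine div_le_div_of_nonneg_left (by positivity) (by positivity) ?_
    exact le_mul_of_one_le_right (by positivity) hK
  set j := ⌊J⌋₊ with hj
  have hjJ : (j : ℝ) ≤ J := Nat.floor_le hJ0
  have hjy : (j : ℝ) ^ ℓ ≤ y := by
    calc (j : ℝ) ^ ℓ ≤ J ^ ℓ := by gcongr
      _ = y := by rw [hJ, ← Real.rpow_mul hy0.le, hq, one_div_mul_cancel hℓ0, Real.rpow_one]
  have hjm : (j : ℝ) ≤ m / (2 * Real.pi) := by
    rcases Nat.eq_zero_or_pos j with h | h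
    · rw [h, Nat.cast_zero]
      positivity
    · have h1 : (1 : ℝ) ≤ j := by exact_mod_cast h
      exact (Real.self_le_rpow_of_one_le h1 hℓ).trans (hjy.trans hym)
  have hjm' : 26 / 5 * (m / (2 * Real.pi)) ≤ (m : ℝ) - j := by
    have h1 : 31 / 5 * (m / (2 * Real.pi)) ≤ (m : ℝ) := by
      rw [← mul_div_assoc, div_le_iff₀ (by positivity)]
      nlinarith
    linarith
  have hjlt : j < m := by
    have : (0 : ℝ) < m - j := lt_of_lt_of_le (by positivity) hjm'
    exact_mod_cast sub_pos.1 this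
  have hbound : ∀ x ∈ Set.Icc (-1 : ℝ) 1, |iteratedDeriv j f x| ≤ A * K ^ j * y ^ j := by
    intro x hx
    refine (hG j x hx).trans ?_
    rw [mul_comm (j : ℝ) ℓ, Real.rpow_mul (by positivity), Real.rpow_natCast]
    gcongr
  obtain ⟨g, hg, hgx⟩ :=
    exists_polynomial_abs_sub_le_of_abs_iteratedDeriv_le j (by positivity) hf hbound hjlt
  refine ⟨g, hg, fun x hx => (hgx x hx).trans ?_⟩
  have hdesc : ((m : ℝ) - j) ^ j ≤ m.descFactorial j := by
    have h1 : ((m - j : ℕ) : ℝ) ^ j ≤ m.descFactorial j := by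
      exact_mod_cast (Nat.pow_le_pow_left (by omega) j).trans (Nat.pow_sub_le_descFactorial m j)
    rwa [Nat.cast_sub hjlt.le] at h1
  have hKy : K * y = m / (2 * Real.pi) := by
    rw [hy]
    field_simp
  have hdpos : (0 : ℝ) < m.descFactorial j := by
    exact_mod_cast Nat.descFactorial_pos.2 hjlt.le
  have hmain : (13 / 5) ^ j * (A * K ^ j * y ^ j) / (m.descFactorial j : ℝ) ≤ A * (1 / 2) ^ j := by
    rw [div_le_iff₀ hdpos]
    calc (13 / 5 : ℝ) ^ j * (A * K ^ j * y ^ j)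
        = A * (1 / 2) ^ j * (26 / 5 * (K * y)) ^ j := by
          rw [show (13 / 5 : ℝ) = 1 / 2 * (26 / 5) by norm_num]
          simp only [mul_pow]
          ring
      _ ≤ A * (1 / 2) ^ j * ((m : ℝ) - j) ^ j := by
          rw [hKy]
          gcongr
      _ ≤ _ := by gcongr
  have hhalf : (1 / 2 : ℝ) ^ j ≤ 2 * 2 ^ (-J) := by
    calc (1 / 2 : ℝ) ^ j = 2 * 2 ^ (-((j : ℝ) + 1)) := by
          rw [Real.rpow_neg zero_le_two, Real.rpow_add_one two_ne_zero, Real.rpow_natCast,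
            one_div, inv_pow]
          field_simp
      _ ≤ _ := by
          have := (Nat.lt_floor_add_one J).le
          gcongr
          norm_num
  rw [hrJ, hB]
  calc _ ≤ A * (1 / 2) ^ j := hmain
    _ ≤ A * (2 * 2 ^ (-J)) := by gcongr
    _ = A * 2 * 2 ^ (-J) := by ring
    _ ≤ _ := by
        gcongr
        nlinarith
end

section
/- Let ℓ, A, K be real numbers with ℓ, A, K ≥ 1 and let f : ℝ → ℝ be infinitely differentiable and satisfy the Gevrey bound with parameters (ℓ, A, K) on [−1,1]. Set q := 1/ℓ, r := 2^(−(2πK)^(−q)) and B := A·(2+πK), and assume additionally r ≥ 2^(−1/(2π)). For a natural number m ≥ 1, let p_m denote the unique polynomial of degree < m that agrees with f at the m Chebyshev nodes x_{m,j} := cos(π·(2j+1)/(2m)), 0 ≤ j < m. Then every polynomial ĝ of degree < m with sup_{x∈[−1,1]} |p_m(x) − ĝ(x)| ≤ m·2^(−m) satisfies sup_{x∈[−1,1]} |f(x) − ĝ(x)| ≤ B̂·(√r)^(m^(1/ℓ)), where B̂ := 1 + 2B·(2ℓ/(e·ln(1/r)))^ℓ. -/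
namespace ChebyshevExpansion

open Real Polynomial MeasureTheory intervalIntegral

/-- For `n : ℤ`, half the `|n|`-th Chebyshev coefficient of `f` (the full one for `n = 0`), so that
`f = ∑ n : ℤ, coeff f n • T n` on `[-1, 1]`. -/
noncomputable def coeff (f : ℝ → ℝ) (n : ℤ) : ℝ :=
  π⁻¹ * ∫ θ in (0 : ℝ)..π, f (cos θ) * cos (n * θ)

lemma coeff_neg (f : ℝ → ℝ) (n : ℤ) : coeff f (-n) = coeff f n := by
  simp [coeff]

lemma abs_coeff_le {f : ℝ → ℝ} {M : ℝ} (hM : ∀ x ∈ Set.Icc (-1 : ℝ) 1, |f x| ≤ M) (n : ℤ) :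
    |coeff f n| ≤ M := by
  have h : ‖∫ θ in (0 : ℝ)..π, f (cos θ) * cos (n * θ)‖ ≤ M * |π - 0| := by
    refine norm_integral_le_of_norm_le_const fun θ _ ↦ ?_
    rw [norm_eq_abs, abs_mul]
    have h1 := hM (cos θ) (cos_mem_Icc θ)
    have h2 := abs_cos_le_one (n * θ)
    nlinarith [abs_nonneg (f (cos θ)), abs_nonneg (cos (n * θ))]
  rw [norm_eq_abs, sub_zero, abs_of_pos pi_pos] at h
  rw [coeff, abs_mul, abs_of_pos (inv_pos.2 pi_pos)]
  rw [inv_mul_le_iff₀ pi_pos]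
  linarith

lemma mul_coeff_eq {f : ℝ → ℝ} (hf : ContDiff ℝ 1 f) (n : ℤ) :
    n * coeff f n = (coeff (deriv f) (n - 1) - coeff (deriv f) (n + 1)) / 2 := by
  have hd : Continuous (deriv f) := hf.continuous_deriv le_rfl
  have hc : Continuous f := hf.continuous
  have hparts := integral_mul_deriv_eq_deriv_mul (a := 0) (b := π)
    (u := fun θ ↦ f (cos θ)) (v := fun θ ↦ sin (n * θ))
    (u' := fun θ ↦ deriv f (cos θ) * -sin θ) (v' := fun θ ↦ cos (n * θ) * n)
    (fun θ _ ↦ ((hf.differentiable one_ne_zero _).hasDerivAt).comp θ (hasDerivAt_cos θ))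
    (fun θ _ ↦ by simpa using ((hasDerivAt_id θ).const_mul (n : ℝ)).sin)
    (by apply Continuous.intervalIntegrable; fun_prop)
    (by apply Continuous.intervalIntegrable; fun_prop)
  simp only [mul_zero, sin_zero, sin_int_mul_pi, sub_zero, zero_sub] at hparts
  have hl : ∫ θ in (0 : ℝ)..π, f (cos θ) * (cos (n * θ) * n) =
      n * ∫ θ in (0 : ℝ)..π, f (cos θ) * cos (n * θ) := by
    rw [← intervalIntegral.integral_const_mul]
    exact integral_congr fun θ _ ↦ by ring
  have hr : -∫ θ in (0 : ℝ)..π, deriv f (cos θ) * -sin θ * sin (n * θ) =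
      ((∫ θ in (0 : ℝ)..π, deriv f (cos θ) * cos ((n - 1 : ℤ) * θ)) -
        ∫ θ in (0 : ℝ)..π, deriv f (cos θ) * cos ((n + 1 : ℤ) * θ)) / 2 := by
    rw [← intervalIntegral.integral_sub (by apply Continuous.intervalIntegrable; fun_prop)
      (by apply Continuous.intervalIntegrable; fun_prop), ← intervalIntegral.integral_div,
      ← intervalIntegral.integral_neg]
    refine integral_congr fun θ _ ↦ ?_
    push_cast
    simp only [sub_mul, add_mul, cos_sub, cos_add, one_mul]
    ring
  rw [hl, hr] at hparts
  rw [coeff, coeff, coeff, mul_left_comm, hparts]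
  ring

lemma abs_coeff_mul_descFactorial_le {M : ℝ} (j : ℕ) :
    ∀ {f : ℝ → ℝ}, ContDiff ℝ j f →
      (∀ x ∈ Set.Icc (-1 : ℝ) 1, |iteratedDeriv j f x| ≤ M) →
      ∀ n : ℕ, |coeff f n| * n.descFactorial j ≤ M := by
  induction j with
  | zero =>
    intro f _ hM n
    simpa using abs_coeff_le (f := f) (by simpa using hM) n
  | succ j ih =>
    intro f hf hM n
    have hM0 : 0 ≤ M := (abs_nonneg _).trans (hM 0 (by simp))
    rcases n with _ | n
    · simpa using hM0
    have hf' : ContDiff ℝ j (deriv f) := by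
      have : ContDiff ℝ ((j : WithTop ℕ∞) + 1) f := by exact_mod_cast hf
      exact this.deriv'
    rw [iteratedDeriv_succ'] at hM
    have h1 := ih hf' hM n
    have h2 := ih hf' hM (n + 2)
    have hdesc : (n.descFactorial j : ℝ) ≤ (n + 2).descFactorial j := by
      exact_mod_cast Nat.descFactorial_le j (by omega)
    have hrec := mul_coeff_eq (hf.of_le (by simp)) (n + 1 : ℤ)
    simp only [add_sub_cancel_right, add_assoc, one_add_one_eq_two] at hrec
    have habs : ((n : ℝ) + 1) * |coeff f (n + 1 : ℤ)| ≤
        (|coeff (deriv f) n| + |coeff (deriv f) (n + 2 : ℤ)|) / 2 := by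
      have h : |((n + 1 : ℤ) : ℝ) * coeff f (n + 1 : ℤ)| ≤
          (|coeff (deriv f) n| + |coeff (deriv f) (n + 2 : ℤ)|) / 2 := by
        rw [hrec, abs_div, abs_two]
        gcongr
        exact abs_sub _ _
      rwa [abs_mul, abs_of_nonneg (by positivity), Int.cast_add, Int.cast_natCast,
        Int.cast_one] at h
    rw [Nat.succ_descFactorial_succ]
    push_cast at h2 ⊢
    have hd0 : (0 : ℝ) ≤ n.descFactorial j := by positivity
    calc |coeff f (n + 1)| * (((n : ℝ) + 1) * n.descFactorial j)
        = ((n : ℝ) + 1) * |coeff f (n + 1)| * n.descFactorial j := by ring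
      _ ≤ (|coeff (deriv f) n| + |coeff (deriv f) (n + 2)|) / 2 * n.descFactorial j := by gcongr
      _ = (|coeff (deriv f) n| * n.descFactorial j +
            |coeff (deriv f) (n + 2)| * n.descFactorial j) / 2 := by ring
      _ ≤ (M + M) / 2 := by
          gcongr
          exact (mul_le_mul_of_nonneg_left hdesc (abs_nonneg _)).trans h2
      _ = M := by ring

lemma inv_descFactorial_eq_sub {N i : ℕ} (h : i < N) :
    ((N + 1).descFactorial (i + 2) : ℝ)⁻¹ =
      (((i : ℝ) + 1) * N.descFactorial (i + 1))⁻¹ -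
        (((i : ℝ) + 1) * (N + 1).descFactorial (i + 1))⁻¹ := by
  have hd : (N.descFactorial i : ℝ) ≠ 0 := by
    exact_mod_cast (Nat.descFactorial_pos.2 h.le).ne'
  have hsub : ((N : ℝ) - i) ≠ 0 := by
    have : (i : ℝ) < N := by exact_mod_cast h
    linarith
  rw [Nat.succ_descFactorial_succ, Nat.succ_descFactorial_succ, Nat.descFactorial_succ]
  push_cast [Nat.cast_sub h.le]
  have : (i : ℝ) + 1 ≠ 0 := by positivity
  have : (N : ℝ) + 1 ≠ 0 := by positivity
  field_simp
  ring

lemma sum_inv_descFactorial_le {N i : ℕ} (h : i < N) (k : ℕ) :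
    ∑ n ∈ Finset.range k, ((N + 1 + n).descFactorial (i + 2) : ℝ)⁻¹ ≤
      (((i : ℝ) + 1) * N.descFactorial (i + 1))⁻¹ := by
  have : ∀ n, ((N + 1 + n).descFactorial (i + 2) : ℝ)⁻¹ =
      (((i : ℝ) + 1) * (N + n).descFactorial (i + 1))⁻¹ -
        (((i : ℝ) + 1) * (N + (n + 1)).descFactorial (i + 1))⁻¹ := fun n ↦ by
    rw [add_right_comm, ← add_assoc]
    exact inv_descFactorial_eq_sub (by omega)
  simp_rw [this]
  rw [Finset.sum_range_sub' (fun n ↦ (((i : ℝ) + 1) * (N + n).descFactorial (i + 1))⁻¹)]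
  simp only [add_zero]
  exact sub_le_self _ (by positivity)

private lemma fact_two_pi_pos : Fact (0 < 2 * π) := ⟨two_pi_pos⟩

attribute [local instance] fact_two_pi_pos

/-- The function `θ ↦ f (cos θ)` on the circle. -/
noncomputable def compCos (f : ℝ → ℝ) (hf : Continuous f) : C(AddCircle (2 * π), ℂ) where
  toFun θ := (f (Real.Angle.cos θ) : ℂ)
  continuous_toFun :=
    Complex.continuous_ofReal.comp (hf.comp Real.Angle.continuous_cos)

lemma compCos_coe (f : ℝ → ℝ) (hf : Continuous f) (θ : ℝ) :
    compCos f hf (θ : AddCircle (2 * π)) = (f (cos θ) : ℂ) := rfl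

lemma fourier_coe_two_pi (n : ℤ) (θ : ℝ) :
    fourier n (θ : AddCircle (2 * π)) = Complex.exp ((n * θ : ℝ) * Complex.I) := by
  rw [fourier_coe_apply]
  congr 1
  have : (π : ℂ) ≠ 0 := by exact_mod_cast pi_ne_zero
  push_cast
  field_simp

lemma fourierCoeff_compCos (f : ℝ → ℝ) (hf : Continuous f) (n : ℤ) :
    fourierCoeff (compCos f hf) n = (coeff f n : ℂ) := by
  set h : ℝ → ℂ := fun θ ↦ Complex.exp ((-n * θ : ℝ) * Complex.I) * (f (cos θ) : ℂ) with hh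
  have hcont : Continuous h := by fun_prop
  have hcont' : Continuous fun θ ↦ h (-θ) := hcont.comp continuous_neg
  have hneg : ∫ θ in (-π)..0, h θ = ∫ θ in (0 : ℝ)..π, h (-θ) := by
    rw [integral_comp_neg]; simp
  have key : ∫ θ in (-π)..π, h θ = ((2 * ∫ θ in (0 : ℝ)..π, f (cos θ) * cos (n * θ) : ℝ) : ℂ) := by
    rw [← integral_add_adjacent_intervals (b := 0) (hcont.intervalIntegrable _ _)
      (hcont.intervalIntegrable _ _), hneg, ← intervalIntegral.integral_add
      (hcont'.intervalIntegrable _ _) (hcont.intervalIntegrable _ _),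
      ← intervalIntegral.integral_const_mul, ← intervalIntegral.integral_ofReal]
    refine integral_congr fun θ _ ↦ ?_
    simp only [hh, cos_neg, Complex.exp_mul_I]
    push_cast
    simp only [neg_mul, mul_neg, neg_neg, Complex.cos_neg, Complex.sin_neg]
    ring
  rw [fourierCoeff_eq_intervalIntegral _ n (-π), show -π + 2 * π = π by ring]
  have hint : ∫ θ in (-π)..π, fourier (-n) (θ : AddCircle (2 * π)) • compCos f hf θ =
      ∫ θ in (-π)..π, h θ := by
    refine integral_congr fun θ _ ↦ ?_
    simp only [fourier_coe_two_pi, compCos_coe, smul_eq_mul, hh, Int.cast_neg]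
  rw [hint, key, coeff, Complex.real_smul, ← Complex.ofReal_mul]
  congr 1
  have := pi_ne_zero
  field_simp

lemma summable_coeff {f : ℝ → ℝ} (hf : ContDiff ℝ 2 f) : Summable (coeff f) := by
  obtain ⟨M, hM⟩ := isCompact_Icc.exists_bound_of_continuousOn (s := Set.Icc (-1 : ℝ) 1)
    (hf.continuous_iteratedDeriv 2 le_rfl).continuousOn
  have hbound (n : ℕ) := abs_coeff_mul_descFactorial_le 2 (M := M) hf hM n
  have hnat : Summable fun n : ℕ ↦ coeff f n := by
    rw [← summable_nat_add_iff 2]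
    have hS : Summable fun n : ℕ ↦ M * ((2 + n).descFactorial 2 : ℝ)⁻¹ :=
      (summable_of_sum_range_le (fun _ ↦ by positivity)
        (sum_inv_descFactorial_le (N := 1) (i := 0) one_pos)).mul_left M
    refine hS.of_norm_bounded fun n ↦ ?_
    have hpos : (0 : ℝ) < (2 + n).descFactorial 2 := by
      exact_mod_cast Nat.descFactorial_pos.2 (by omega)
    rw [← div_eq_mul_inv, le_div_iff₀ hpos, add_comm 2 n]
    exact hbound (n + 2)
  exact .of_nat_of_neg hnat (by simpa only [coeff_neg] using hnat)

/-- The Chebyshev expansion of a `C²` function. -/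
theorem hasSum_coeff_mul_eval_T {f : ℝ → ℝ} (hf : ContDiff ℝ 2 f) {x : ℝ}
    (hx : x ∈ Set.Icc (-1 : ℝ) 1) :
    HasSum (fun n : ℤ ↦ coeff f n * (Chebyshev.T ℝ n).eval x) (f x) := by
  have hsum : Summable (fourierCoeff (compCos f hf.continuous)) := by
    simp_rw [funext (fourierCoeff_compCos f hf.continuous)]
    exact_mod_cast summable_coeff hf
  have h := Complex.hasSum_re
    (has_pointwise_sum_fourier_series_of_summable hsum (arccos x : AddCircle (2 * π)))
  have hcos : cos (arccos x) = x := cos_arccos hx.1 hx.2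
  rw [compCos_coe, hcos, Complex.ofReal_re] at h
  convert h using 2 with n
  rw [fourierCoeff_compCos, fourier_coe_two_pi, smul_eq_mul, Complex.re_ofReal_mul,
    Complex.exp_ofReal_mul_I_re, ← Chebyshev.T_real_cos, hcos]


/-- The `j`-th node of Chebyshev interpolation by polynomials of degree less than `m`. -/
noncomputable def node (m j : ℕ) : ℝ := cos (π * (2 * (j : ℝ) + 1) / (2 * (m : ℝ)))

lemma node_mem_Icc (m j : ℕ) : node m j ∈ Set.Icc (-1 : ℝ) 1 := cos_mem_Icc _

lemma injOn_node {m : ℕ} (hm : 1 ≤ m) : Set.InjOn (node m) (Finset.range m) := by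
  have hm0 : (0 : ℝ) < m := by exact_mod_cast hm
  have hmem : ∀ j ∈ Finset.range m, π * (2 * (j : ℝ) + 1) / (2 * (m : ℝ)) ∈ Set.Icc 0 π := by
    intro j hj
    have : (j : ℝ) + 1 ≤ m := by exact_mod_cast Finset.mem_range.1 hj
    refine ⟨by positivity, ?_⟩
    rw [div_le_iff₀ (by positivity)]
    gcongr
    linarith
  intro i hi j hj hij
  have h := injOn_cos (hmem i hi) (hmem j hj) hij
  have := pi_ne_zero
  field_simp at h
  exact_mod_cast (by linarith : (i : ℝ) = j)

/-- On the Chebyshev nodes, `T n` coincides with a polynomial of degree `< m` that is bounded by `1`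
on `[-1, 1]`. -/
lemma exists_eval_node_eq_eval_T {m : ℕ} (hm : 1 ≤ m) (n : ℤ) :
    ∃ g : ℝ[X], g.degree < m ∧ (∀ x ∈ Set.Icc (-1 : ℝ) 1, |g.eval x| ≤ 1) ∧
      ∀ j, g.eval (node m j) = (Chebyshev.T ℝ n).eval (node m j) := by
  have hm0 : (m : ℝ) ≠ 0 := by positivity
  obtain ⟨u, k, rfl, hk1, hk2⟩ : ∃ u k : ℤ, n = k + 2 * m * u ∧ -(m : ℤ) ≤ k ∧ k < m := by
    refine ⟨(n + m) / (2 * m), (n + m) % (2 * m) - m, ?_, ?_, ?_⟩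
    · linarith [Int.emod_add_mul_ediv (n + m) (2 * m)]
    · linarith [Int.emod_nonneg (n + m) (by omega : (2 * m : ℤ) ≠ 0)]
    · linarith [Int.emod_lt_of_pos (n + m) (by omega : (0 : ℤ) < 2 * m)]
  have hshift (j : ℕ) : (Chebyshev.T ℝ (k + 2 * m * u)).eval (node m j) =
      (-1) ^ u * (Chebyshev.T ℝ k).eval (node m j) := by
    rw [node, Chebyshev.T_real_cos, Chebyshev.T_real_cos]
    have harg : ((k + 2 * m * u : ℤ) : ℝ) * (π * (2 * (j : ℝ) + 1) / (2 * (m : ℝ))) =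
        k * (π * (2 * (j : ℝ) + 1) / (2 * (m : ℝ))) + ((2 * (u * j) + u : ℤ) : ℝ) * π := by
      push_cast
      field_simp
    rw [harg, cos_add_int_mul_pi, zpow_add₀ (by norm_num), zpow_mul]
    norm_num
  rcases hk1.eq_or_lt with rfl | hk1
  · refine ⟨0, by simp, by simp, fun j ↦ ?_⟩
    rw [hshift, node, Chebyshev.T_neg, Chebyshev.T_real_cos]
    have harg : ((m : ℤ) : ℝ) * (π * (2 * (j : ℝ) + 1) / (2 * (m : ℝ))) = π / 2 + (j : ℤ) * π := by
      push_cast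
      field_simp
      ring
    rw [harg, cos_add_int_mul_pi]
    simp
  · refine ⟨C ((-1) ^ u) * Chebyshev.T ℝ k, ?_, fun x hx ↦ ?_, fun j ↦ ?_⟩
    · rw [degree_C_mul (zpow_ne_zero _ (by norm_num)), Chebyshev.degree_T]
      exact_mod_cast (by omega : k.natAbs < m)
    · rw [eval_mul, eval_C, abs_mul, abs_zpow, abs_neg, abs_one, one_zpow, one_mul]
      exact Chebyshev.abs_eval_T_real_le_one k (abs_le.2 hx)
    · rw [eval_mul, eval_C, hshift]

lemma eval_eq_sum_node_mul_basis {m : ℕ} (hm : 1 ≤ m) {g : ℝ[X]} (hg : g.degree < m) (x : ℝ) :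
    g.eval x = ∑ j ∈ Finset.range m,
      g.eval (node m j) * (Lagrange.basis (Finset.range m) (node m) j).eval x := by
  conv_lhs => rw [Lagrange.eq_interpolate (injOn_node hm) (by simpa using hg : g.degree < _)]
  simp [Lagrange.interpolate_apply, eval_finsetSum]

lemma degree_lt_of_natDegree_lt {m : ℕ} {p : ℝ[X]} (hp : p.natDegree < m) : p.degree < m :=
  degree_le_natDegree.trans_lt (by exact_mod_cast hp)

/-- Interpolation error at Chebyshev nodes in terms of the derivative of order `i + 2`. -/
theorem abs_sub_eval_le_of_iteratedDeriv {f : ℝ → ℝ} {i m : ℕ} {M : ℝ} (him : i + 2 ≤ m)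
    (hf : ContDiff ℝ (i + 2 : ℕ) f)
    (hM : ∀ x ∈ Set.Icc (-1 : ℝ) 1, |iteratedDeriv (i + 2) f x| ≤ M)
    {p : ℝ[X]} (hp : p.degree < m) (hinterp : ∀ j < m, p.eval (node m j) = f (node m j))
    {x : ℝ} (hx : x ∈ Set.Icc (-1 : ℝ) 1) :
    |f x - p.eval x| ≤ 4 * M * (((i : ℝ) + 1) * (m - 1).descFactorial (i + 1))⁻¹ := by
  have hm : 1 ≤ m := by omega
  have hM0 : 0 ≤ M := (abs_nonneg _).trans (hM 0 (by simp))
  have hf2 : ContDiff ℝ 2 f := hf.of_le (by exact_mod_cast (by omega : 2 ≤ i + 2))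
  choose g hgdeg hgle hgnode using exists_eval_node_eq_eval_T hm
  have hgT (n : ℤ) (hn : n.natAbs < m) : g n = Chebyshev.T ℝ n :=
    eq_of_degrees_lt_of_eval_index_eq _ (injOn_node hm) (by simpa using hgdeg n)
      (by simpa [Chebyshev.degree_T] using hn) fun j _ ↦ hgnode n j
  have hpsum : HasSum (fun n : ℤ ↦ coeff f n * (g n).eval x) (p.eval x) := by
    rw [eval_eq_sum_node_mul_basis hm hp]
    simp_rw [eval_eq_sum_node_mul_basis hm (hgdeg _) x, hgnode, Finset.mul_sum]
    refine hasSum_sum fun j hj ↦ ?_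
    simp_rw [← mul_assoc]
    rw [hinterp j (Finset.mem_range.1 hj)]
    exact (hasSum_coeff_mul_eval_T hf2 (node_mem_Icc m j)).mul_right _
  set D : ℤ → ℝ := fun n ↦ coeff f n * ((Chebyshev.T ℝ n).eval x - (g n).eval x) with hD
  have hDsum : HasSum D (f x - p.eval x) := by
    simpa only [hD, mul_sub] using (hasSum_coeff_mul_eval_T hf2 hx).sub hpsum
  have hD0 (n : ℤ) (hn : n.natAbs < m) : D n = 0 := by simp [hD, hgT n hn]
  have hDle (n : ℤ) : |D n| ≤ 2 * |coeff f n| := by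
    rw [hD, abs_mul, mul_comm]
    gcongr
    have h1 := Chebyshev.abs_eval_T_real_le_one n (abs_le.2 hx)
    exact (abs_sub _ _).trans (by linarith [hgle n x hx])
  have htail : HasSum (fun n : ℕ ↦ D (n + m : ℕ) + D (-(n + m : ℕ))) (f x - p.eval x) := by
    have h := hDsum.nat_add_neg
    rw [hD0 0 (by simp; omega), add_zero] at h
    have h2 := (hasSum_nat_add_iff' m).2 h
    rwa [Finset.sum_eq_zero, sub_zero] at h2
    intro n hn
    have := Finset.mem_range.1 hn
    rw [hD0 _ (by simpa using this), hD0 _ (by simpa using this), add_zero]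
  have hsumle := sum_inv_descFactorial_le (N := m - 1) (i := i) (by omega)
  rw [Nat.sub_add_cancel hm] at hsumle
  have hS := (summable_of_sum_range_le (fun _ ↦ by positivity) hsumle).hasSum.mul_left (4 * M)
  refine (htail.norm_le_of_bounded hS fun n ↦ ?_).trans ?_
  · have hpos : (0 : ℝ) < (m + n).descFactorial (i + 2) := by
      exact_mod_cast Nat.descFactorial_pos.2 (by omega)
    rw [← div_eq_mul_inv, le_div_iff₀ hpos, add_comm m n]
    have h1 := hDle (n + m : ℕ)
    have h2 := hDle (-(n + m : ℕ))
    rw [coeff_neg] at h2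
    rw [add_comm m n] at hpos
    calc ‖D (n + m : ℕ) + D (-(n + m : ℕ))‖ * (n + m).descFactorial (i + 2)
        ≤ 4 * |coeff f (n + m : ℕ)| * (n + m).descFactorial (i + 2) := by
          gcongr
          exact (norm_add_le _ _).trans (by simp only [norm_eq_abs]; linarith)
      _ = 4 * (|coeff f (n + m : ℕ)| * (n + m).descFactorial (i + 2)) := by ring
      _ ≤ 4 * M := by
          gcongr
          exact abs_coeff_mul_descFactorial_le (i + 2) hf hM (n + m)
  · gcongr
    exact Real.tsum_le_of_sum_range_le (fun _ ↦ by positivity) hsumle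

lemma contDiff_eval (p : ℝ[X]) {n : WithTop ℕ∞} : ContDiff ℝ n fun x ↦ p.eval x := by
  simpa [aeval_def] using p.contDiff_aeval (𝕜 := ℝ) n

lemma iteratedDeriv_eval (p : ℝ[X]) (j : ℕ) :
    iteratedDeriv j (fun x ↦ p.eval x) = fun x ↦ (derivative^[j] p).eval x := by
  induction j generalizing p with
  | zero => simp
  | succ j ih =>
    rw [iteratedDeriv_succ', Function.iterate_succ_apply, ← ih]
    congr 1
    ext x
    simp

lemma abs_coeff_eval_le {m : ℕ} (hm : 1 ≤ m) {p : ℝ[X]} (hp : p.degree < m) {A : ℝ}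
    (hA : ∀ j < m, |p.eval (node m j)| ≤ A) {n : ℤ} (hn : n.natAbs < m) :
    |coeff (fun x ↦ p.eval x) n| ≤ A := by
  have hm0 : (0 : ℝ) < m := by exact_mod_cast hm
  have hdeg : (p * Chebyshev.T ℝ n).degree < 2 * m := by
    rw [degree_mul, two_mul, Chebyshev.degree_T]
    exact WithBot.add_lt_add_of_lt_of_le (by simp) hp (by exact_mod_cast hn.le)
  have h := Chebyshev.integral_eq_sumZeroes (by omega : m ≠ 0) hdeg
  rw [Chebyshev.integral_measureT_eq_integral_cos] at h
  simp only [eval_mul, Chebyshev.T_real_cos] at h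
  rw [coeff, h, Chebyshev.sumZeroes, ← mul_assoc, abs_mul]
  have habs : |π⁻¹ * (π / m)| = (m : ℝ)⁻¹ := by
    have := pi_ne_zero
    rw [show π⁻¹ * (π / m) = (m : ℝ)⁻¹ by field_simp, abs_of_pos (by positivity)]
  rw [habs, inv_mul_le_iff₀ hm0]
  refine (Finset.abs_sum_le_sum_abs _ _).trans ?_
  refine (Finset.sum_le_card_nsmul _ _ A fun j hj ↦ ?_).trans (by simp)
  have hnode : cos ((2 * (j : ℝ) + 1) / (2 * m) * π) = node m j := by
    rw [node]; congr 1; ring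
  rw [hnode, eval_mul, abs_mul]
  have h1 := hA j (Finset.mem_range.1 hj)
  have h2 := Chebyshev.abs_eval_T_real_le_one n (abs_le.2 (node_mem_Icc m j))
  exact (mul_le_of_le_one_right (abs_nonneg _) h2).trans h1

/-- A crude bound for the Lebesgue constant of the Chebyshev nodes. -/
theorem abs_eval_le_of_abs_eval_node_le {m : ℕ} (hm : 1 ≤ m) {p : ℝ[X]} (hp : p.natDegree < m)
    {A : ℝ} (hA : ∀ j < m, |p.eval (node m j)| ≤ A) {x : ℝ} (hx : x ∈ Set.Icc (-1 : ℝ) 1) :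
    |p.eval x| ≤ (2 * m - 1) * A := by
  have hzero (n : ℤ) (hn : n ∉ Finset.Ioo (-(m : ℤ)) m) : coeff (fun x ↦ p.eval x) n = 0 := by
    have hn' : m ≤ n.natAbs := by
      rw [Finset.mem_Ioo] at hn; omega
    have hder : ∀ x ∈ Set.Icc (-1 : ℝ) 1, |iteratedDeriv m (fun x ↦ p.eval x) x| ≤ 0 := by
      intro x _
      rw [iteratedDeriv_eval]
      simp [iterate_derivative_eq_zero hp]
    have hpos : (0 : ℝ) < n.natAbs.descFactorial m := by
      exact_mod_cast Nat.descFactorial_pos.2 hn'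
    have h := abs_coeff_mul_descFactorial_le m (contDiff_eval p) hder n.natAbs
    have h' : coeff (fun x ↦ p.eval x) (n.natAbs : ℤ) = 0 :=
      abs_nonpos_iff.1 (nonpos_of_mul_nonpos_left h hpos)
    rcases Int.natAbs_eq n with hn | hn
    · rwa [← hn] at h'
    · rw [hn, coeff_neg, h']
  have h := (hasSum_coeff_mul_eval_T (contDiff_eval p (n := 2)) hx).unique
    (hasSum_sum_of_ne_finset_zero (s := Finset.Ioo (-(m : ℤ)) m) fun n hn ↦ by simp [hzero n hn])
  rw [h]
  refine (Finset.abs_sum_le_sum_abs _ _).trans ?_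
  refine (Finset.sum_le_card_nsmul _ _ A fun n hn ↦ ?_).trans (le_of_eq ?_)
  · rw [abs_mul]
    have h1 := abs_coeff_eval_le hm (degree_lt_of_natDegree_lt hp) hA
      (by rw [Finset.mem_Ioo] at hn; omega : n.natAbs < m)
    have h2 := Chebyshev.abs_eval_T_real_le_one n (abs_le.2 hx)
    exact (mul_le_of_le_one_right (abs_nonneg _) h2).trans h1
  · have : (m - -m - 1 : ℤ).toNat = 2 * m - 1 := by omega
    rw [Int.card_Ioo, this, nsmul_eq_mul, Nat.cast_sub (by omega)]
    push_cast
    ring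

lemma mul_exp_neg_mul_rpow_le {ℓ c m : ℝ} (hℓ : 0 < ℓ) (hc : 0 < c) (hm : 0 ≤ m) :
    m * exp (-(c * m ^ (1 / ℓ))) ≤ (ℓ / (exp 1 * c)) ^ ℓ := by
  set y := m ^ (1 / ℓ) with hy
  have hy0 : 0 ≤ y := rpow_nonneg hm _
  have hym : y ^ ℓ = m := by
    rw [hy, ← rpow_mul hm, one_div_mul_cancel hℓ.ne', rpow_one]
  have hbase : y * exp (-(c * y / ℓ)) ≤ ℓ / (exp 1 * c) := by
    have h := add_one_le_exp (c * y / ℓ - 1)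
    rw [exp_sub, sub_add_cancel, le_div_iff₀ (exp_pos 1)] at h
    rw [exp_neg, ← div_eq_mul_inv, div_le_div_iff₀ (exp_pos _) (by positivity)]
    calc y * (exp 1 * c) = ℓ * (c * y / ℓ * exp 1) := by field_simp
      _ ≤ ℓ * exp (c * y / ℓ) := by gcongr
  calc m * exp (-(c * y)) = (y * exp (-(c * y / ℓ))) ^ ℓ := by
        rw [mul_rpow hy0 (exp_pos _).le, hym, ← exp_mul]
        congr 2
        field_simp
    _ ≤ _ := rpow_le_rpow (by positivity) hbase hℓ.le

lemma mul_two_rpow_neg_le {m t : ℝ} (hm : 0 ≤ m) (ht : t ≤ m / 6) :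
    m * (2 : ℝ) ^ (-m) ≤ (2 : ℝ) ^ (-(t / 2)) := by
  have hexp : m ≤ exp (m / 2) := by
    have h := add_one_le_exp (m / 4)
    have h2 : exp (m / 2) = exp (m / 4) * exp (m / 4) := by rw [← exp_add]; ring_nf
    rw [h2]
    nlinarith [sq_nonneg (m / 4 - 1)]
  have hlog := log_two_gt_d9
  rw [rpow_def_of_pos two_pos, rpow_def_of_pos two_pos]
  calc m * exp (log 2 * -m) ≤ exp (m / 2) * exp (log 2 * -m) := by gcongr
    _ = exp (m / 2 + log 2 * -m) := (exp_add _ _).symm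
    _ ≤ exp (log 2 * -(t / 2)) := by
        gcongr
        nlinarith [mul_nonneg hm (by linarith : 0 ≤ log 2 - 0.69)]

lemma four_mul_div_descFactorial_le {i m : ℕ} {A : ℝ} (hA : 0 ≤ A) (him : 2 * (i + 2) ≤ m) :
    4 * (A * (m / (2 * π)) ^ (i + 2)) * (((i : ℝ) + 1) * (m - 1).descFactorial (i + 1))⁻¹ ≤
      2 * A * m * (1 / 2) ^ (i + 2) := by
  have hm0 : (0 : ℝ) < m := by exact_mod_cast (by omega : 0 < m)
  have hpow : ((m : ℝ) / 2) ^ (i + 1) ≤ ((i : ℝ) + 1) * (m - 1).descFactorial (i + 1) := by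
    have h := Nat.pow_sub_le_descFactorial (m - 1) (i + 1)
    have h' : (((m - 1 + 1 - (i + 1) : ℕ) : ℝ)) ^ (i + 1) ≤ (m - 1).descFactorial (i + 1) := by
      exact_mod_cast h
    have hhalf : (m : ℝ) / 2 ≤ ((m - 1 + 1 - (i + 1) : ℕ) : ℝ) := by
      rw [div_le_iff₀ two_pos]
      exact_mod_cast (by omega : m ≤ (m - 1 + 1 - (i + 1)) * 2)
    calc ((m : ℝ) / 2) ^ (i + 1) ≤ (((m - 1 + 1 - (i + 1) : ℕ) : ℝ)) ^ (i + 1) := by gcongr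
      _ ≤ (m - 1).descFactorial (i + 1) := h'
      _ ≤ ((i : ℝ) + 1) * (m - 1).descFactorial (i + 1) :=
          le_mul_of_one_le_left (by positivity) (by linarith [(Nat.cast_nonneg i : (0 : ℝ) ≤ i)])
  calc 4 * (A * (m / (2 * π)) ^ (i + 2)) * (((i : ℝ) + 1) * (m - 1).descFactorial (i + 1))⁻¹
      ≤ 4 * (A * (m / (2 * π)) ^ (i + 2)) * (((m : ℝ) / 2) ^ (i + 1))⁻¹ := by gcongr
    _ = 2 * A * m * (1 / π) ^ (i + 2) := by
        rw [show (m : ℝ) / (2 * π) = m / 2 * (1 / π) by field_simp, mul_pow, pow_succ (_ / 2)]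
        have : ((m : ℝ) / 2) ^ (i + 1) ≠ 0 := by positivity
        field_simp
        ring
    _ ≤ 2 * A * m * (1 / 2) ^ (i + 2) := by
        gcongr
        exact two_le_pi

/-- Chebyshev interpolation error for functions satisfying a Gevrey bound. -/
theorem abs_sub_eval_le_of_gevrey {ℓ A K : ℝ} (hℓ : 1 ≤ ℓ) (hA : 1 ≤ A) (hK : 1 ≤ K)
    {f : ℝ → ℝ} (hf : ContDiff ℝ (⊤ : ℕ∞) f)
    (hG : ∀ j : ℕ, ∀ x ∈ Set.Icc (-1 : ℝ) 1,
      |iteratedDeriv j f x| ≤ A * K ^ j * (j : ℝ) ^ ((j : ℝ) * ℓ))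
    {m : ℕ} (hm : 1 ≤ m) {t : ℝ} (ht0 : 0 ≤ t) (ht : t ^ ℓ = m / (2 * π * K))
    (htm : t ≤ m / 2) {p : ℝ[X]} (hp : p.natDegree < m)
    (hinterp : ∀ j < m, p.eval (node m j) = f (node m j))
    {x : ℝ} (hx : x ∈ Set.Icc (-1 : ℝ) 1) :
    |f x - p.eval x| ≤ 2 * (A * (2 + π * K)) * m * (2 : ℝ) ^ (-t) := by
  have hm0 : (0 : ℝ) < m := by exact_mod_cast hm
  have hA0 : 0 < A := by linarith
  have hK0 : 0 < K := by linarith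
  have hpiK : 2 ≤ π * K := by nlinarith [pi_gt_three]
  have hfA : ∀ y ∈ Set.Icc (-1 : ℝ) 1, |f y| ≤ A := fun y hy ↦ by simpa using hG 0 y hy
  rcases lt_or_ge t 2 with ht2 | ht2
  · have h1 := abs_eval_le_of_abs_eval_node_le hm hp
      (fun j hj ↦ by rw [hinterp j hj]; exact hfA _ (node_mem_Icc m j)) hx
    have h2 : (1 / 4 : ℝ) ≤ (2 : ℝ) ^ (-t) := by
      calc (1 / 4 : ℝ) = (2 : ℝ) ^ (-2 : ℝ) := by
            rw [rpow_neg two_pos.le, rpow_two]; norm_num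
        _ ≤ (2 : ℝ) ^ (-t) := rpow_le_rpow_of_exponent_le one_le_two (by linarith)
    calc |f x - p.eval x| ≤ |f x| + |p.eval x| := abs_sub _ _
      _ ≤ A + (2 * m - 1) * A := add_le_add (hfA x hx) h1
      _ = 2 * (A * (2 + 2)) * m * (1 / 4) := by ring
      _ ≤ 2 * (A * (2 + π * K)) * m * (2 : ℝ) ^ (-t) := by gcongr
  · obtain ⟨i, hi⟩ : ∃ i, ⌊t⌋₊ = i + 2 :=
      ⟨⌊t⌋₊ - 2, (Nat.sub_add_cancel (Nat.le_floor (by exact_mod_cast ht2))).symm⟩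
    have hit : ((i + 2 : ℕ) : ℝ) ≤ t := hi ▸ Nat.floor_le ht0
    have hti : t ≤ ((i + 2 : ℕ) : ℝ) + 1 := hi ▸ (Nat.lt_floor_add_one t).le
    have him : 2 * (i + 2) ≤ m := by
      have : 2 * ((i + 2 : ℕ) : ℝ) ≤ m := by linarith
      exact_mod_cast this
    have hM : ∀ y ∈ Set.Icc (-1 : ℝ) 1,
        |iteratedDeriv (i + 2) f y| ≤ A * (m / (2 * π)) ^ (i + 2) := fun y hy ↦ by
      refine (hG (i + 2) y hy).trans ?_
      rw [mul_comm ((i + 2 : ℕ) : ℝ) ℓ, rpow_mul (Nat.cast_nonneg _), rpow_natCast, mul_assoc,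
        ← mul_pow]
      gcongr
      calc K * ((i + 2 : ℕ) : ℝ) ^ ℓ ≤ K * t ^ ℓ := by gcongr
        _ = m / (2 * π) := by rw [ht]; field_simp
    have htwo : ((1 : ℝ) / 2) ^ (i + 2) ≤ 2 * (2 : ℝ) ^ (-t) := by
      calc ((1 : ℝ) / 2) ^ (i + 2) = 2 * (2 : ℝ) ^ (-(((i + 2 : ℕ) : ℝ) + 1)) := by
            rw [rpow_neg two_pos.le, rpow_add_one two_ne_zero, rpow_natCast, one_div, inv_pow]
            field_simp
        _ ≤ 2 * (2 : ℝ) ^ (-t) := by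
            gcongr
            exact one_le_two
    calc |f x - p.eval x|
        ≤ 4 * (A * (m / (2 * π)) ^ (i + 2)) *
            (((i : ℝ) + 1) * (m - 1).descFactorial (i + 1))⁻¹ :=
          abs_sub_eval_le_of_iteratedDeriv (by omega) (contDiff_infty.1 hf (i + 2)) hM
            (degree_lt_of_natDegree_lt hp) hinterp hx
      _ ≤ 2 * A * m * (1 / 2) ^ (i + 2) := four_mul_div_descFactorial_le hA0.le him
      _ ≤ 2 * A * m * (2 * (2 : ℝ) ^ (-t)) := by gcongr
      _ = 2 * (A * 2) * m * (2 : ℝ) ^ (-t) := by ring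
      _ ≤ 2 * (A * (2 + π * K)) * m * (2 : ℝ) ^ (-t) := by
          gcongr
          linarith

end ChebyshevExpansion


/-- Proposition 4(e): with `f` Gevrey-(ℓ,A,K) on `[−1,1]`, `q = 1/ℓ`,
`r = 2^(−(2πK)^(−q)) ≥ 2^(−1/(2π))`, `B = A·(2+πK)`, let `p` be the polynomial of
degree `< m` interpolating `f` at the `m` Chebyshev nodes `cos(π(2j+1)/(2m))`.
Then every polynomial `ghat` of degree `< m` with `sup_{[−1,1]} |p − ghat| ≤ m·2^(−m)`
satisfies `sup_{[−1,1]} |f − ghat| ≤ B̂·(√r)^(m^(1/ℓ))` where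
`B̂ = 1 + 2B·(2ℓ/(e·ln(1/r)))^ℓ`. -/
theorem stmt_4 (ℓ A K : ℝ) (hℓ : 1 ≤ ℓ) (hA : 1 ≤ A) (hK : 1 ≤ K)
    (f : ℝ → ℝ) (hf : ContDiff ℝ (⊤ : ℕ∞) f)
    (hG : ∀ j : ℕ, ∀ x ∈ Set.Icc (-1 : ℝ) 1,
      |iteratedDeriv j f x| ≤ A * K ^ j * (j : ℝ) ^ ((j : ℝ) * ℓ))
    (q r B : ℝ) (hq : q = 1 / ℓ)
    (hr : r = (2 : ℝ) ^ (-(2 * Real.pi * K) ^ (-q)))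
    (hB : B = A * (2 + Real.pi * K))
    (hr2 : (2 : ℝ) ^ (-(1 / (2 * Real.pi))) ≤ r)
    (m : ℕ) (hm : 1 ≤ m) (p : Polynomial ℝ) (hp : p.natDegree < m)
    (hinterp : ∀ j : ℕ, j < m →
      p.eval (Real.cos (Real.pi * (2 * (j : ℝ) + 1) / (2 * (m : ℝ)))) =
        f (Real.cos (Real.pi * (2 * (j : ℝ) + 1) / (2 * (m : ℝ)))))
    (ghat : Polynomial ℝ) (hghat : ghat.natDegree < m)
    (hround : ∀ x ∈ Set.Icc (-1 : ℝ) 1,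
      |p.eval x - ghat.eval x| ≤ (m : ℝ) * (2 : ℝ) ^ (-(m : ℝ))) :
    ∀ x ∈ Set.Icc (-1 : ℝ) 1,
      |f x - ghat.eval x| ≤
        (1 + 2 * B * (2 * ℓ / (Real.exp 1 * Real.log (1 / r))) ^ ℓ) *
          Real.sqrt r ^ ((m : ℝ) ^ (1 / ℓ)) := by
  intro x hx
  have hπ := Real.pi_gt_three
  have hℓ0 : 0 < ℓ := by linarith
  have hm1 : (1 : ℝ) ≤ m := by exact_mod_cast hm
  have hT0 : 0 < 2 * Real.pi * K := by positivity
  set s : ℝ := (2 * Real.pi * K) ^ (-q) with hs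
  have hs0 : 0 < s := Real.rpow_pos_of_pos hT0 _
  have hsle : s ≤ 1 / (2 * Real.pi) := by
    rw [hr, Real.rpow_le_rpow_left_iff one_lt_two] at hr2
    linarith
  have hlog2 : 0 < Real.log 2 := Real.log_pos one_lt_two
  have hlogr : Real.log (1 / r) = s * Real.log 2 := by
    rw [one_div, Real.log_inv, hr, Real.log_rpow two_pos]
    ring
  set y : ℝ := (m : ℝ) ^ (1 / ℓ) with hy
  have hy0 : 0 ≤ y := by positivity
  have hym : y ≤ m := by
    calc y ≤ (m : ℝ) ^ (1 : ℝ) :=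
          Real.rpow_le_rpow_of_exponent_le hm1 ((div_le_one hℓ0).2 hℓ)
      _ = m := Real.rpow_one _
  have htm : s * y ≤ m / (2 * Real.pi) := by
    calc s * y ≤ 1 / (2 * Real.pi) * m := by gcongr
      _ = m / (2 * Real.pi) := by ring
  have htpow : (s * y) ^ ℓ = m / (2 * Real.pi * K) := by
    rw [Real.mul_rpow hs0.le hy0, hs, hy, hq, ← Real.rpow_mul hT0.le,
      ← Real.rpow_mul (by positivity), one_div_mul_cancel hℓ0.ne', neg_mul,
      one_div_mul_cancel hℓ0.ne', Real.rpow_neg_one, Real.rpow_one, div_eq_inv_mul]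
  have hρ : Real.sqrt r ^ y = (2 : ℝ) ^ (-(s * y / 2)) := by
    rw [Real.sqrt_eq_rpow, hr, ← Real.rpow_mul two_pos.le, ← Real.rpow_mul two_pos.le]
    ring_nf
  have hsq : (2 : ℝ) ^ (-(s * y)) = (2 : ℝ) ^ (-(s * y / 2)) * (2 : ℝ) ^ (-(s * y / 2)) := by
    rw [← Real.rpow_add two_pos]
    ring_nf
  have hfp := ChebyshevExpansion.abs_sub_eval_le_of_gevrey hℓ hA hK hf hG hm (by positivity) htpow
    (htm.trans (by gcongr; linarith)) hp hinterp hx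
  have hpg := (hround x hx).trans (ChebyshevExpansion.mul_two_rpow_neg_le (by positivity)
    (htm.trans (by gcongr; linarith)))
  have hweight : (m : ℝ) * (2 : ℝ) ^ (-(s * y / 2)) ≤
      (2 * ℓ / (Real.exp 1 * Real.log (1 / r))) ^ ℓ := by
    have h := ChebyshevExpansion.mul_exp_neg_mul_rpow_le (c := s * Real.log 2 / 2) hℓ0
      (by positivity) (Nat.cast_nonneg m)
    convert h using 2
    · rw [Real.rpow_def_of_pos two_pos, ← hy]
      ring_nf
    · rw [hlogr]
      field_simp
  have hB0 : 0 ≤ B := by rw [hB]; positivity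
  rw [← hB, hsq] at hfp
  rw [hρ]
  calc |f x - ghat.eval x| ≤ |f x - p.eval x| + |p.eval x - ghat.eval x| := abs_sub_le _ _ _
    _ ≤ 2 * B * m * ((2 : ℝ) ^ (-(s * y / 2)) * (2 : ℝ) ^ (-(s * y / 2))) +
        (2 : ℝ) ^ (-(s * y / 2)) := add_le_add hfp hpg
    _ = (1 + 2 * B * (m * (2 : ℝ) ^ (-(s * y / 2)))) * (2 : ℝ) ^ (-(s * y / 2)) := by ring
    _ ≤ _ := by gcongr
end

section
/- Let ℓ, A, K be real numbers with ℓ, A, K ≥ 1 and let f : ℝ → ℝ be infinitely differentiable and satisfy the Gevrey bound with parameters (ℓ, A, K) on [−1,1]. Then for all natural numbers d ≥ 1 and j ≥ 1 and all x ∈ [−1,1]: |f^{(d+j)}(x)| ≤ A_d · K_d^j · j^(j·ℓ), where A_d := A·K^d·(2d²ℓ/e)^(d·ℓ) and K_d := K·e·(2d)^ℓ. In particular every derivative of f again satisfies a Gevrey bound with the same exponent ℓ. -/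
/-- The inequality `log t ≤ t - 1` at `t = y / (x * ℓ)`, rearranged. -/
lemma log_le_log_add_div_sub {x y ℓ : ℝ} (hx : 0 < x) (hy : 0 < y) (hℓ : 0 < ℓ) :
    x * ℓ * Real.log y ≤ x * ℓ * (Real.log x + Real.log ℓ - 1) + y := by
  have hxl : 0 < x * ℓ := mul_pos hx hℓ
  have h := Real.log_le_sub_one_of_pos (div_pos hy hxl)
  rw [Real.log_div hy.ne' hxl.ne', Real.log_mul hx.ne' hℓ.ne'] at h
  have h2 := mul_le_mul_of_nonneg_left h hxl.le
  have h3 : x * ℓ * (y / (x * ℓ) - 1) = y - x * ℓ := by field_simp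
  linarith

lemma add_rpow_add_mul_le {ℓ : ℝ} (hℓ : 1 ≤ ℓ) {d j : ℕ} (hd : 1 ≤ d) (hj : 1 ≤ j) :
    ((d + j : ℕ) : ℝ) ^ (((d + j : ℕ) : ℝ) * ℓ) ≤
      (2 * (d : ℝ) ^ 2 * ℓ / Real.exp 1) ^ ((d : ℝ) * ℓ) *
        (Real.exp 1 * (2 * (d : ℝ)) ^ ℓ) ^ j * (j : ℝ) ^ ((j : ℝ) * ℓ) := by
  have hd1 : (1 : ℝ) ≤ d := by exact_mod_cast hd
  have hj1 : (1 : ℝ) ≤ j := by exact_mod_cast hj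
  have hd0 : (0 : ℝ) < d := by linarith
  have hj0 : (0 : ℝ) < j := by linarith
  have hℓ0 : 0 < ℓ := by linarith
  push_cast
  rw [← Real.log_le_log_iff (by positivity) (by positivity),
    Real.log_mul (by positivity) (by positivity), Real.log_mul (by positivity) (by positivity),
    Real.log_pow, Real.log_mul (by positivity) (by positivity),
    Real.log_rpow (by positivity), Real.log_rpow (by positivity), Real.log_rpow (by positivity),
    Real.log_rpow (by positivity), Real.log_div (by positivity) (by positivity), Real.log_exp,
    Real.log_mul (by positivity) (by positivity), Real.log_mul (by positivity) (by positivity),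
    Real.log_mul (by positivity) (by positivity), Real.log_pow]
  have h1 : Real.log (d + j) ≤ Real.log 2 + Real.log d + Real.log j := by
    rw [← Real.log_mul (by positivity) (by positivity),
      ← Real.log_mul (by positivity) (by positivity)]
    exact Real.log_le_log (by positivity) (by nlinarith)
  have h2 := mul_le_mul_of_nonneg_left h1 (by positivity : (0 : ℝ) ≤ (d + j) * ℓ)
  have h3 := log_le_log_add_div_sub hd0 hj0 hℓ0
  push_cast
  linarith

lemma iteratedDeriv_iteratedDeriv (f : ℝ → ℝ) (d j : ℕ) :
    iteratedDeriv j (iteratedDeriv d f) = iteratedDeriv (d + j) f := by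
  simp only [iteratedDeriv_eq_iterate]
  rw [add_comm, Function.iterate_add_apply]

/-- Proposition 4(f): if `f` is Gevrey-(ℓ,A,K) on `[−1,1]` then for `d, j ≥ 1`,
`|f^{(d+j)}(x)| ≤ A_d·K_d^j·j^(jℓ)` with `A_d = A·K^d·(2d²ℓ/e)^(dℓ)` and
`K_d = K·e·(2d)^ℓ`; in particular every derivative of `f` again satisfies a
Gevrey bound with the same exponent `ℓ`. -/
theorem stmt_5 (ℓ A K : ℝ) (hℓ : 1 ≤ ℓ) (hA : 1 ≤ A) (hK : 1 ≤ K)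
    (f : ℝ → ℝ) (hf : ContDiff ℝ (⊤ : ℕ∞) f)
    (hG : ∀ j : ℕ, ∀ x ∈ Set.Icc (-1 : ℝ) 1,
      |iteratedDeriv j f x| ≤ A * K ^ j * (j : ℝ) ^ ((j : ℝ) * ℓ)) :
    (∀ d j : ℕ, 1 ≤ d → 1 ≤ j → ∀ x ∈ Set.Icc (-1 : ℝ) 1,
      |iteratedDeriv (d + j) f x| ≤
        (A * K ^ d * (2 * (d : ℝ) ^ 2 * ℓ / Real.exp 1) ^ ((d : ℝ) * ℓ)) *
          (K * Real.exp 1 * (2 * (d : ℝ)) ^ ℓ) ^ j * (j : ℝ) ^ ((j : ℝ) * ℓ)) ∧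
    (∀ d : ℕ, ∃ A' K' : ℝ, 1 ≤ A' ∧ 1 ≤ K' ∧
      ∀ j : ℕ, ∀ x ∈ Set.Icc (-1 : ℝ) 1,
        |iteratedDeriv j (iteratedDeriv d f) x| ≤
          A' * K' ^ j * (j : ℝ) ^ ((j : ℝ) * ℓ)) := by
  have key : ∀ d j : ℕ, 1 ≤ d → 1 ≤ j → ∀ x ∈ Set.Icc (-1 : ℝ) 1,
      |iteratedDeriv (d + j) f x| ≤
        (A * K ^ d * (2 * (d : ℝ) ^ 2 * ℓ / Real.exp 1) ^ ((d : ℝ) * ℓ)) *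
          (K * Real.exp 1 * (2 * (d : ℝ)) ^ ℓ) ^ j * (j : ℝ) ^ ((j : ℝ) * ℓ) := by
    intro d j hd hj x hx
    refine (hG (d + j) x hx).trans ?_
    refine (mul_le_mul_of_nonneg_left (add_rpow_add_mul_le hℓ hd hj)
      (by positivity)).trans_eq ?_
    rw [pow_add, mul_assoc K, mul_pow K]
    ring
  refine ⟨key, fun d => ?_⟩
  rcases Nat.eq_zero_or_pos d with rfl | hd
  · exact ⟨A, K, hA, hK, by simpa using hG⟩
  have hd1 : (1 : ℝ) ≤ d := by exact_mod_cast hd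
  have hB : 1 ≤ A * K ^ d * (d : ℝ) ^ ((d : ℝ) * ℓ) :=
    one_le_mul_of_one_le_of_one_le
      (one_le_mul_of_one_le_of_one_le hA (one_le_pow₀ hK))
      (Real.one_le_rpow hd1 (by positivity))
  have hC : 0 ≤ A * K ^ d * (2 * (d : ℝ) ^ 2 * ℓ / Real.exp 1) ^ ((d : ℝ) * ℓ) := by
    positivity
  refine ⟨A * K ^ d * (2 * (d : ℝ) ^ 2 * ℓ / Real.exp 1) ^ ((d : ℝ) * ℓ) +
    A * K ^ d * (d : ℝ) ^ ((d : ℝ) * ℓ), K * Real.exp 1 * (2 * (d : ℝ)) ^ ℓ,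
    by linarith, ?_, fun j x hx => ?_⟩
  · exact one_le_mul_of_one_le_of_one_le
      (one_le_mul_of_one_le_of_one_le hK (Real.one_le_exp zero_le_one))
      (Real.one_le_rpow (by linarith) (by linarith))
  rw [iteratedDeriv_iteratedDeriv]
  rcases Nat.eq_zero_or_pos j with rfl | hj
  · have h := hG d x hx
    simp only [add_zero, pow_zero, mul_one, Nat.cast_zero, zero_mul, Real.rpow_zero]
    linarith
  · refine (key d j hd hj x hx).trans ?_
    gcongr
    linarith
end

section
/- Let ℓ ≥ 1 be real and let A, B, K, L ≥ 1 be real. Let f, g : ℝ → ℝ be infinitely differentiable with f mapping [−1,1] into [−1,1], and suppose that for all n ≥ 1 and all x, y ∈ [−1,1]: |f^{(n)}(x)| ≤ A·K^n·n^(n·ℓ) and |g^{(n)}(y)| ≤ B·L^n·n^(n·ℓ). Then for all n ≥ 1 and all x ∈ [−1,1]: |(g∘f)^{(n)}(x)| ≤ C·M^n·n^(n·ℓ), where C := B·(e·ℓ/2)^(ℓ/2) and M := e·A·K·L. -/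
namespace OrderedFinpartition

theorem prod_partSize_extendLeft {n : ℕ} {M : Type*} [CommMonoid M] (c : OrderedFinpartition n)
    (φ : ℕ → M) :
    ∏ i, φ (c.extendLeft.partSize i) = φ 1 * ∏ i, φ (c.partSize i) :=
  Fin.prod_univ_succ (n := c.length) _

theorem prod_partSize_extendMiddle {n : ℕ} {M : Type*} [CommMonoid M] (c : OrderedFinpartition n)
    (φ : ℕ → M) (k : Fin c.length) :
    φ (c.partSize k) * ∏ i, φ ((c.extendMiddle k).partSize i) =
      φ (c.partSize k + 1) * ∏ i, φ (c.partSize i) := by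
  change φ (c.partSize k) * ∏ i : Fin c.length,
    φ (Function.update c.partSize k (c.partSize k + 1) i) = _
  rw [← Finset.mul_prod_erase Finset.univ _ (Finset.mem_univ k),
    ← Finset.mul_prod_erase Finset.univ (fun i => φ (c.partSize i)) (Finset.mem_univ k),
    Function.update_self, mul_left_comm]
  congr 2
  refine Finset.prod_congr rfl fun i hi => ?_
  rw [Function.update_of_ne (Finset.ne_of_mem_erase hi)]

theorem sum_partSize {n : ℕ} (c : OrderedFinpartition n) : ∑ i, c.partSize i = n := by
  have h := c.sum_sigma_eq_sum (fun _ : Fin n => 1)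
  simp only [Finset.sum_const, Finset.card_univ, Fintype.card_fin, smul_eq_mul, mul_one] at h
  exact h

end OrderedFinpartition

theorem succ_pow_succ_mul_self_le (n : ℕ) :
    (n + 1) ^ (n + 1) * (n + 1) ^ (n + 1) ≤ (n + 2) ^ (n + 2) * n ^ n := by
  have h := one_add_mul_le_pow (a := -(1 / ((n : ℝ) + 1) ^ 2)) (by
    have : 1 / ((n : ℝ) + 1) ^ 2 ≤ 1 := by
      rw [div_le_one (by positivity)]; nlinarith [n.cast_nonneg (α := ℝ)]
    linarith) n
  have e : 1 + -(1 / ((n : ℝ) + 1) ^ 2) = n * (n + 2) / (n + 1) ^ 2 := by field_simp; ring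
  have e' : 1 + (n : ℝ) * -(1 / ((n : ℝ) + 1) ^ 2) = (n ^ 2 + n + 1) / (n + 1) ^ 2 := by
    field_simp; ring
  rw [e, e', div_pow, mul_pow, div_le_div_iff₀ (by positivity) (by positivity)] at h
  have key : ((n + 1 : ℝ) ^ 2) * (n + 1) ^ 2 ≤ (n ^ 2 + n + 1) * (n + 2) ^ 2 := by
    nlinarith [n.cast_nonneg (α := ℝ), pow_nonneg (n.cast_nonneg (α := ℝ)) 3]
  have : ((n + 1 : ℝ) ^ (n + 1) * (n + 1 : ℝ) ^ (n + 1)) * (n + 1 : ℝ) ^ 2 ≤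
      (((n : ℝ) + 2) ^ (n + 2) * (n : ℝ) ^ n) * ((n : ℝ) + 1) ^ 2 := by
    calc ((n + 1 : ℝ) ^ (n + 1) * (n + 1 : ℝ) ^ (n + 1)) * (n + 1 : ℝ) ^ 2
        = ((n + 1 : ℝ) ^ 2 * (n + 1) ^ 2) * ((n + 1) ^ 2) ^ n := by rw [← pow_mul]; ring
      _ ≤ ((n ^ 2 + n + 1 : ℝ) * (n + 2) ^ 2) * ((n + 1) ^ 2) ^ n := by gcongr ?_ * _
      _ = ((n ^ 2 + n + 1 : ℝ) * ((n + 1) ^ 2) ^ n) * (n + 2) ^ 2 := by ring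
      _ ≤ ((n : ℝ) ^ n * (n + 2) ^ n * (n + 1) ^ 2) * (n + 2) ^ 2 := by gcongr ?_ * _
      _ = _ := by ring
  exact_mod_cast le_of_mul_le_mul_right this (by positivity)

theorem succ_pow_succ_mul_pow_le {j n : ℕ} (h : j ≤ n) :
    (j + 1) ^ (j + 1) * n ^ n ≤ (n + 1) ^ (n + 1) * j ^ j := by
  induction n, h using Nat.le_induction with
  | base => exact le_rfl
  | succ n _ ih =>
    refine Nat.le_of_mul_le_mul_right ?_ (Nat.pow_self_pos (n := n))
    calc (j + 1) ^ (j + 1) * (n + 1) ^ (n + 1) * n ^ n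
        = (j + 1) ^ (j + 1) * n ^ n * (n + 1) ^ (n + 1) := by ring
      _ ≤ (n + 1) ^ (n + 1) * j ^ j * (n + 1) ^ (n + 1) := by gcongr ?_ * _
      _ = (n + 1) ^ (n + 1) * (n + 1) ^ (n + 1) * j ^ j := by ring
      _ ≤ (n + 2) ^ (n + 2) * n ^ n * j ^ j := by
        gcongr ?_ * _
        exact succ_pow_succ_mul_self_le n
      _ = _ := by ring

theorem factorial_succ_mul_two_pow_le (n : ℕ) : (n + 1).factorial * 2 ^ n ≤ (n + 1) ^ (n + 1) := by
  induction n with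
  | zero => simp
  | succ n ih =>
    have h : 2 * (n + 1) ^ (n + 1) ≤ (n + 2) ^ (n + 1) := by
      calc 2 * (n + 1) ^ (n + 1) = (n + 1) ^ (n + 1) + (n + 1) * (n + 1) ^ n * 1 := by ring
        _ ≤ (n + 1 + 1) ^ (n + 1) := by
          simpa using pow_add_mul_le_add_pow (a := n + 1) (b := 1) (n := n + 1)
    calc (n + 2).factorial * 2 ^ (n + 1) = (n + 2) * (2 * ((n + 1).factorial * 2 ^ n)) := by
          rw [Nat.factorial_succ (n + 1)]; ring
      _ ≤ (n + 2) * (2 * (n + 1) ^ (n + 1)) := by gcongr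
      _ ≤ (n + 2) * (n + 2) ^ (n + 1) := by gcongr
      _ = _ := by ring

theorem exp_one_mul_self_pow_self_le {n : ℕ} (hn : 1 ≤ n) :
    Real.exp 1 * (n : ℝ) ^ n ≤ Real.exp 1 ^ n * n.factorial := by
  induction n, hn using Nat.le_induction with
  | base => simp
  | succ n hn ih =>
    have hn' : (0 : ℝ) < n := by exact_mod_cast hn
    have h : ((n : ℝ) + 1) ^ n ≤ Real.exp 1 * (n : ℝ) ^ n := by
      calc ((n : ℝ) + 1) ^ n = (n * ((n : ℝ)⁻¹ + 1)) ^ n := by congr 1; field_simp; ring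
        _ ≤ (n * Real.exp (n : ℝ)⁻¹) ^ n := by gcongr; exact Real.add_one_le_exp _
        _ = Real.exp 1 * (n : ℝ) ^ n := by
          rw [mul_pow, ← Real.exp_nat_mul, mul_inv_cancel₀ hn'.ne', mul_comm]
    calc Real.exp 1 * ((n + 1 : ℕ) : ℝ) ^ (n + 1)
        = Real.exp 1 * (n + 1) * ((n : ℝ) + 1) ^ n := by push_cast; ring
      _ ≤ Real.exp 1 * (n + 1) * (Real.exp 1 * (n : ℝ) ^ n) := by gcongr
      _ ≤ Real.exp 1 * (n + 1) * (Real.exp 1 ^ n * n.factorial) := by gcongr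
      _ = _ := by rw [Nat.factorial_succ]; push_cast; ring

namespace OrderedFinpartition

open Polynomial

theorem length_pow_mul_prod_partSize_pow_le {n : ℕ} (c : OrderedFinpartition n) :
    c.length ^ c.length * ∏ i, c.partSize i ^ c.partSize i ≤ n ^ n := by
  induction n with
  | zero =>
    have h : c.length = 0 := Nat.le_zero.1 c.length_le
    have : IsEmpty (Fin c.length) := by rw [h]; infer_instance
    simp [h]
  | succ n ih =>
    obtain ⟨⟨c, k⟩, rfl⟩ := (extendEquiv n).surjective c
    have hn : 0 < n ^ n := Nat.pow_self_pos
    refine Nat.le_of_mul_le_mul_right ?_ hn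
    cases k with
    | none =>
      have hp := c.prod_partSize_extendLeft (fun j => j ^ j)
      simp only [one_pow, one_mul] at hp
      change c.extendLeft.length ^ c.extendLeft.length *
        (∏ i, c.extendLeft.partSize i ^ c.extendLeft.partSize i) * _ ≤ _
      rw [hp]
      change (c.length + 1) ^ (c.length + 1) * _ * _ ≤ _
      calc _ = ((c.length + 1) ^ (c.length + 1) * n ^ n) * ∏ i, c.partSize i ^ c.partSize i := by
            ring
        _ ≤ ((n + 1) ^ (n + 1) * c.length ^ c.length) * ∏ i, c.partSize i ^ c.partSize i := by
            gcongr ?_ * _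
            exact succ_pow_succ_mul_pow_le c.length_le
        _ = (n + 1) ^ (n + 1) * (c.length ^ c.length * ∏ i, c.partSize i ^ c.partSize i) := by ring
        _ ≤ _ := by gcongr; exact ih c
    | some k =>
      have hp := c.prod_partSize_extendMiddle (fun j => j ^ j) k
      change c.length ^ c.length *
        (∏ i, (c.extendMiddle k).partSize i ^ (c.extendMiddle k).partSize i) * _ ≤ _
      refine Nat.le_of_mul_le_mul_right ?_ (Nat.pow_self_pos (n := c.partSize k))
      set P := ∏ i, (c.extendMiddle k).partSize i ^ (c.extendMiddle k).partSize i
      calc c.length ^ c.length * P * n ^ n * c.partSize k ^ c.partSize k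
          = c.length ^ c.length * n ^ n * (c.partSize k ^ c.partSize k * P) := by ring
        _ = ((c.partSize k + 1) ^ (c.partSize k + 1) * n ^ n) *
            (c.length ^ c.length * ∏ i, c.partSize i ^ c.partSize i) := by rw [hp]; ring
        _ ≤ ((n + 1) ^ (n + 1) * c.partSize k ^ c.partSize k) * n ^ n := by
            gcongr ?_ * ?_
            · exact succ_pow_succ_mul_pow_le (c.partSize_le k)
            · exact ih c
        _ = _ := by ring

/-- The generating polynomial of the ordered partitions of `Fin n` by length, weighted by the
factorials of the length and of the block sizes. -/
noncomputable def lahPolynomial (n : ℕ) : ℤ[X] :=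
  ∑ c : OrderedFinpartition n,
    (c.length.factorial * ∏ i, (c.partSize i).factorial) • X ^ c.length

theorem lahPolynomial_succ (n : ℕ) :
    lahPolynomial (n + 1) =
      X * (1 + X) * derivative (lahPolynomial n) + (X + (n : ℤ[X])) * lahPolynomial n := by
  rw [lahPolynomial, ← (extendEquiv n).sum_comp, Fintype.sum_sigma, lahPolynomial,
    derivative_sum, Finset.mul_sum, Finset.mul_sum, ← Finset.sum_add_distrib]
  refine Finset.sum_congr rfl fun c _ => ?_
  have hm (k : Fin c.length) : ∏ i, ((c.extendMiddle k).partSize i).factorial =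
      (c.partSize k + 1) * ∏ i, (c.partSize i).factorial := by
    refine Nat.eq_of_mul_eq_mul_left (c.partSize k).factorial_pos ?_
    rw [c.prod_partSize_extendMiddle Nat.factorial k, Nat.factorial_succ]
    ring
  have hd : X * derivative (X ^ c.length : ℤ[X]) = (c.length : ℤ[X]) * X ^ c.length := by
    cases c.length with
    | zero => simp
    | succ m =>
      rw [derivative_X_pow]
      simp only [Nat.add_sub_cancel, map_natCast]
      ring
  rw [Fintype.sum_option]
  change ((c.length + 1).factorial * ∏ i, (c.extendLeft.partSize i).factorial) •
      (X : ℤ[X]) ^ (c.length + 1) +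
    ∑ k : Fin c.length, (c.length.factorial * ∏ i, ((c.extendMiddle k).partSize i).factorial) •
      (X : ℤ[X]) ^ c.length = _
  simp only [hm]
  rw [c.prod_partSize_extendLeft Nat.factorial]
  rw [← Finset.sum_smul, ← Finset.mul_sum, ← Finset.sum_mul, Finset.sum_add_distrib,
    c.sum_partSize, derivative_smul]
  set W := ∏ i, (c.partSize i).factorial
  simp only [nsmul_eq_mul, Finset.sum_const, Finset.card_univ, Fintype.card_fin, smul_eq_mul,
    mul_one, Nat.factorial_succ, Nat.factorial_zero]
  push_cast
  linear_combination (-(1 + X) * (c.length.factorial * W : ℤ[X])) * hd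

theorem lahPolynomial_succ_eq (n : ℕ) :
    lahPolynomial (n + 1) = ((n + 1).factorial : ℤ[X]) * (X * (1 + X) ^ n) := by
  induction n with
  | zero =>
    have : lahPolynomial 0 = 1 := by
      rw [lahPolynomial, Fintype.sum_unique]
      simp
    rw [lahPolynomial_succ, this]; simp
  | succ n ih =>
    rw [lahPolynomial_succ, ih, Nat.factorial_succ (n + 1)]
    cases n with
    | zero => simp; ring
    | succ n =>
      simp [derivative_mul, derivative_pow]
      ring

theorem sum_length_factorial_mul_prod (n : ℕ) :
    ∑ c : OrderedFinpartition (n + 1), c.length.factorial * ∏ i, (c.partSize i).factorial =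
      (n + 1).factorial * 2 ^ n := by
  have h := congrArg (eval 1) (lahPolynomial_succ_eq n)
  simp only [lahPolynomial, eval_finsetSum, eval_pow, eval_X, one_pow, eval_mul,
    eval_natCast, eval_add, eval_one, one_mul, one_add_one_eq_two, nsmul_eq_mul, mul_one] at h
  exact_mod_cast h

theorem exp_one_mul_length_pow_mul_prod_le {n : ℕ} (hn : 1 ≤ n) (c : OrderedFinpartition n) :
    Real.exp 1 * ((c.length : ℝ) ^ c.length * ∏ i, (c.partSize i : ℝ) ^ c.partSize i) ≤
      Real.exp 1 ^ n * (c.length.factorial * ∏ i, ((c.partSize i).factorial : ℝ)) := by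
  have h₁ := exp_one_mul_self_pow_self_le (c.length_pos hn)
  have h₂ : ∏ i, (Real.exp 1 * (c.partSize i : ℝ) ^ c.partSize i) ≤
      ∏ i, (Real.exp 1 ^ c.partSize i * ((c.partSize i).factorial : ℝ)) :=
    Finset.prod_le_prod (fun _ _ => by positivity)
      fun i _ => exp_one_mul_self_pow_self_le (c.partSize_pos i)
  rw [Finset.prod_mul_distrib, Finset.prod_mul_distrib, Finset.prod_pow_eq_pow_sum,
    c.sum_partSize, Finset.prod_const, Finset.card_univ, Fintype.card_fin] at h₂
  have h := mul_le_mul h₁ h₂ (by positivity) (by positivity)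
  refine le_of_mul_le_mul_left ?_ (pow_pos (Real.exp_pos 1) c.length)
  linear_combination h

theorem sum_length_pow_mul_prod_rpow_le {n : ℕ} (hn : 1 ≤ n) {ℓ : ℝ} (hℓ : 1 ≤ ℓ) :
    ∑ c : OrderedFinpartition n, ((c.length : ℝ) ^ ((c.length : ℝ) * ℓ) *
      ∏ i, (c.partSize i : ℝ) ^ ((c.partSize i : ℝ) * ℓ)) ≤
      Real.exp 1 ^ n * (n : ℝ) ^ ((n : ℝ) * ℓ) := by
  have hn' : (0 : ℝ) < (n : ℝ) ^ n := by positivity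
  have hpow (m : ℕ) : (m : ℝ) ^ ((m : ℝ) * ℓ) = ((m : ℝ) ^ m) ^ ℓ := by
    rw [Real.rpow_mul m.cast_nonneg, Real.rpow_natCast]
  have hterm (c : OrderedFinpartition n) : (c.length : ℝ) ^ ((c.length : ℝ) * ℓ) *
      ∏ i, (c.partSize i : ℝ) ^ ((c.partSize i : ℝ) * ℓ) ≤
      Real.exp 1 ^ n * (c.length.factorial * ∏ i, ((c.partSize i).factorial : ℝ)) *
        ((n : ℝ) ^ n) ^ (ℓ - 1) := by
    simp only [hpow]
    rw [Real.finsetProd_rpow _ _ fun _ _ => by positivity,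
      ← Real.mul_rpow (by positivity) (Finset.prod_nonneg fun _ _ => by positivity)]
    set S := (c.length : ℝ) ^ c.length * ∏ i, (c.partSize i : ℝ) ^ c.partSize i with hS
    have hc := c.length_pos hn
    have hS0 : 0 < S := mul_pos (by positivity) (Finset.prod_pos fun i _ => by
      have := c.partSize_pos i
      positivity)
    have hSn : S ≤ (n : ℝ) ^ n := by
      rw [hS]
      exact_mod_cast c.length_pow_mul_prod_partSize_pow_le
    have hSe : S ≤ Real.exp 1 ^ n *
        (c.length.factorial * ∏ i, ((c.partSize i).factorial : ℝ)) :=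
      (le_mul_of_one_le_left hS0.le (Real.one_le_exp zero_le_one)).trans
        (c.exp_one_mul_length_pow_mul_prod_le hn)
    calc S ^ ℓ = S * S ^ (ℓ - 1) := by
          rw [← Real.rpow_one_add' hS0.le (by linarith)]; congr 1; ring
      _ ≤ _ := by
          gcongr
  refine (Finset.sum_le_sum fun c _ => hterm c).trans ?_
  rw [← Finset.sum_mul, ← Finset.mul_sum, hpow]
  obtain ⟨m, rfl⟩ := Nat.exists_eq_add_of_le' hn
  have hsum : ∑ c : OrderedFinpartition (m + 1),
      ((c.length.factorial : ℝ) * ∏ i, ((c.partSize i).factorial : ℝ)) ≤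
      ((m + 1 : ℕ) : ℝ) ^ (m + 1) := by
    exact_mod_cast (sum_length_factorial_mul_prod m).trans_le (factorial_succ_mul_two_pow_le m)
  calc _ ≤ Real.exp 1 ^ (m + 1) * ((m + 1 : ℕ) : ℝ) ^ (m + 1) *
        (((m + 1 : ℕ) : ℝ) ^ (m + 1)) ^ (ℓ - 1) := by gcongr
    _ = _ := by
      rw [mul_assoc, ← Real.rpow_one_add' hn'.le (by linarith)]; congr 2; ring

end OrderedFinpartition

/-- Faà di Bruno's formula bounds the iterated derivatives of a composition by a sum over
ordered partitions. -/
theorem abs_iteratedDeriv_comp_le {f g : ℝ → ℝ} {n : ℕ} {x : ℝ} (hg : ContDiffAt ℝ n g (f x))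
    (hf : ContDiffAt ℝ n f x) :
    |iteratedDeriv n (g ∘ f) x| ≤ ∑ c : OrderedFinpartition n,
      |iteratedDeriv c.length g (f x)| * ∏ i, |iteratedDeriv (c.partSize i) f x| := by
  simp only [← Real.norm_eq_abs, ← norm_iteratedFDeriv_eq_norm_iteratedDeriv]
  rw [iteratedFDeriv_comp hg hf le_rfl]
  exact (norm_sum_le _ _).trans
    (Finset.sum_le_sum fun c _ => c.norm_compAlongOrderedFinpartition_le _ _)


/-- Proposition 4(h): composition of Gevrey functions. If `f` maps `[−1,1]` into `[−1,1]`
and `|f^{(n)}| ≤ A·K^n·n^(nℓ)`, `|g^{(n)}| ≤ B·L^n·n^(nℓ)` on `[−1,1]` for all `n ≥ 1`,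
then `|(g∘f)^{(n)}| ≤ C·M^n·n^(nℓ)` on `[−1,1]` for all `n ≥ 1`, where
`C = B·(eℓ/2)^(ℓ/2)` and `M = e·A·K·L`. -/
theorem stmt_7 (ℓ A B K L : ℝ) (hℓ : 1 ≤ ℓ)
    (hA : 1 ≤ A) (hB : 1 ≤ B) (hK : 1 ≤ K) (hL : 1 ≤ L)
    (f g : ℝ → ℝ) (hf : ContDiff ℝ (⊤ : ℕ∞) f) (hg : ContDiff ℝ (⊤ : ℕ∞) g)
    (hmap : Set.MapsTo f (Set.Icc (-1 : ℝ) 1) (Set.Icc (-1 : ℝ) 1))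
    (hGf : ∀ n : ℕ, 1 ≤ n → ∀ x ∈ Set.Icc (-1 : ℝ) 1,
      |iteratedDeriv n f x| ≤ A * K ^ n * (n : ℝ) ^ ((n : ℝ) * ℓ))
    (hGg : ∀ n : ℕ, 1 ≤ n → ∀ y ∈ Set.Icc (-1 : ℝ) 1,
      |iteratedDeriv n g y| ≤ B * L ^ n * (n : ℝ) ^ ((n : ℝ) * ℓ)) :
    ∀ n : ℕ, 1 ≤ n → ∀ x ∈ Set.Icc (-1 : ℝ) 1,
      |iteratedDeriv n (g ∘ f) x| ≤
        (B * (Real.exp 1 * ℓ / 2) ^ (ℓ / 2)) *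
          (Real.exp 1 * A * K * L) ^ n * (n : ℝ) ^ ((n : ℝ) * ℓ) := by
  intro n hn x hx
  have hA0 : 0 < A := by linarith
  have hB0 : 0 < B := by linarith
  have hK0 : 0 < K := by linarith
  have hL0 : 0 < L := by linarith
  have hC : 1 ≤ (Real.exp 1 * ℓ / 2) ^ (ℓ / 2) := by
    refine Real.one_le_rpow ?_ (by linarith)
    nlinarith [Real.add_one_le_exp (1 : ℝ)]
  have hterm (c : OrderedFinpartition n) :
      |iteratedDeriv c.length g (f x)| * ∏ i, |iteratedDeriv (c.partSize i) f x| ≤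
        B * (A * K * L) ^ n * ((c.length : ℝ) ^ ((c.length : ℝ) * ℓ) *
          ∏ i, (c.partSize i : ℝ) ^ ((c.partSize i : ℝ) * ℓ)) := by
    have hP : 0 ≤ ∏ i, (c.partSize i : ℝ) ^ ((c.partSize i : ℝ) * ℓ) :=
      Finset.prod_nonneg fun _ _ => by positivity
    calc |iteratedDeriv c.length g (f x)| * ∏ i, |iteratedDeriv (c.partSize i) f x|
        ≤ (B * L ^ c.length * (c.length : ℝ) ^ ((c.length : ℝ) * ℓ)) *
          ∏ i, (A * K ^ c.partSize i * (c.partSize i : ℝ) ^ ((c.partSize i : ℝ) * ℓ)) := by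
          gcongr
          · exact hGg _ (c.length_pos hn) _ (hmap hx)
          · exact hGf _ (c.partSize_pos _) _ hx
      _ = B * (A ^ c.length * K ^ n * L ^ c.length) * ((c.length : ℝ) ^ ((c.length : ℝ) * ℓ) *
          ∏ i, (c.partSize i : ℝ) ^ ((c.partSize i : ℝ) * ℓ)) := by
          rw [Finset.prod_mul_distrib, Finset.prod_mul_distrib, Finset.prod_pow_eq_pow_sum,
            c.sum_partSize, Finset.prod_const, Finset.card_univ, Fintype.card_fin]
          ring
      _ ≤ _ := by
          rw [mul_pow, mul_pow]
          gcongr <;> exact c.length_le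
  have hle : ((n : ℕ∞) : WithTop ℕ∞) ≤ ((⊤ : ℕ∞) : WithTop ℕ∞) := by exact_mod_cast le_top
  calc |iteratedDeriv n (g ∘ f) x|
      ≤ _ := abs_iteratedDeriv_comp_le (hg.of_le hle).contDiffAt (hf.of_le hle).contDiffAt
    _ ≤ _ := Finset.sum_le_sum fun c _ => hterm c
    _ ≤ B * (A * K * L) ^ n * (Real.exp 1 ^ n * (n : ℝ) ^ ((n : ℝ) * ℓ)) := by
        rw [← Finset.mul_sum]
        gcongr
        exact OrderedFinpartition.sum_length_pow_mul_prod_rpow_le hn hℓ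
    _ = (B * 1) * (Real.exp 1 * A * K * L) ^ n * (n : ℝ) ^ ((n : ℝ) * ℓ) := by ring
    _ ≤ _ := by gcongr
end

section
/- Let h : ℝ → ℝ be defined by h(x) = exp(−1/x) for x > 0 and h(x) = 0 for x ≤ 0 (the standard smooth non-analytic function). Then h belongs to the Gevrey class G_3 on [−1,1]: there exist real constants A, K ≥ 1 such that for every n ∈ ℕ and every x ∈ [−1,1], |h^{(n)}(x)| ≤ A·K^n·n^(3n) (with the convention 0^0 = 1). -/
open Polynomial in
theorem deriv_inv_pow_mul_expNegInvGlue (k : ℕ) :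
    deriv (fun x : ℝ ↦ x⁻¹ ^ k * expNegInvGlue x) =
      (fun x : ℝ ↦ x⁻¹ ^ (k + 2) * expNegInvGlue x) -
        (k : ℝ) • (fun x : ℝ ↦ x⁻¹ ^ (k + 1) * expNegInvGlue x) := by
  funext x
  have h := (expNegInvGlue.hasDerivAt_polynomial_eval_inv_mul (X ^ k) x).deriv
  simp only [eval_pow, eval_X] at h
  rw [h]
  rcases k with _ | k
  · simp
  · simp
    ring

open Polynomial in
theorem contDiff_inv_pow_mul_expNegInvGlue (n : ℕ∞) (k : ℕ) :
    ContDiff ℝ n (fun x : ℝ ↦ x⁻¹ ^ k * expNegInvGlue x) := by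
  simpa using expNegInvGlue.contDiff_polynomial_eval_inv_mul (n := n) (X ^ k)

theorem abs_inv_pow_mul_expNegInvGlue_le (k : ℕ) (x : ℝ) :
    |x⁻¹ ^ k * expNegInvGlue x| ≤ (k.factorial : ℝ) := by
  rcases le_or_gt x 0 with hx | hx
  · simp [expNegInvGlue.zero_of_nonpos hx]
  · have hy : 0 < x⁻¹ := inv_pos.2 hx
    have h := Real.pow_div_factorial_le_exp x⁻¹ hy.le k
    rw [div_le_iff₀ (by positivity)] at h
    rw [expNegInvGlue, if_neg hx.not_ge, abs_of_pos (by positivity), Real.exp_neg,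
      mul_inv_le_iff₀ (Real.exp_pos _)]
    linarith

theorem abs_iteratedDeriv_inv_pow_mul_expNegInvGlue_le (n k : ℕ) (x : ℝ) :
    |iteratedDeriv n (fun x : ℝ ↦ x⁻¹ ^ k * expNegInvGlue x) x| ≤
      2 ^ n * ((k + 2 * n).factorial : ℝ) := by
  induction n generalizing k with
  | zero => simpa using abs_inv_pow_mul_expNegInvGlue_le k x
  | succ n ih =>
    have hc (j : ℕ) : ContDiffAt ℝ n (fun x : ℝ ↦ x⁻¹ ^ j * expNegInvGlue x) x :=
      (contDiff_inv_pow_mul_expNegInvGlue n j).contDiffAt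
    have hs (j : ℕ) : ContDiffAt ℝ n ((k : ℝ) • fun x : ℝ ↦ x⁻¹ ^ j * expNegInvGlue x) x :=
      (hc j).const_smul (k : ℝ)
    rw [iteratedDeriv_succ', deriv_inv_pow_mul_expNegInvGlue,
      iteratedDeriv_sub (hc _) (hs _), iteratedDeriv_const_smul (hc _)]
    have h1 := ih (k + 2)
    have h2 := ih (k + 1)
    have hk : (k : ℝ) * ((k + 1 + 2 * n).factorial : ℝ) ≤ ((k + 2 + 2 * n).factorial : ℝ) := by
      rw [show k + 2 + 2 * n = (k + 1 + 2 * n) + 1 by ring, Nat.factorial_succ]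
      push_cast
      gcongr
      linarith [(Nat.cast_nonneg n : (0 : ℝ) ≤ n)]
    refine (abs_sub _ _).trans ?_
    rw [smul_eq_mul, abs_mul, abs_of_nonneg (Nat.cast_nonneg k : (0 : ℝ) ≤ k),
      show k + 2 * (n + 1) = k + 2 + 2 * n by ring]
    calc _ ≤ 2 ^ n * ((k + 2 + 2 * n).factorial : ℝ) +
          k * (2 ^ n * ((k + 1 + 2 * n).factorial : ℝ)) := by gcongr
      _ = 2 ^ n * (((k + 2 + 2 * n).factorial : ℝ) + k * ((k + 1 + 2 * n).factorial : ℝ)) := by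
        ring
      _ ≤ 2 ^ n * (((k + 2 + 2 * n).factorial : ℝ) + ((k + 2 + 2 * n).factorial : ℝ)) := by
        gcongr
      _ = _ := by ring

theorem factorial_two_mul_le (n : ℕ) : (2 * n).factorial ≤ 4 ^ n * n ^ (n * 3) := by
  rcases Nat.eq_zero_or_pos n with rfl | hn
  · simp
  · calc (2 * n).factorial ≤ (2 * n) ^ (2 * n) := Nat.factorial_le_pow _
      _ = 4 ^ n * n ^ (2 * n) := by rw [mul_pow, pow_mul]; norm_num
      _ ≤ 4 ^ n * n ^ (n * 3) := by
        exact Nat.mul_le_mul_left _ (Nat.pow_le_pow_right hn (by omega))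

/-- Example 9(a): the standard smooth non-analytic function `h(x) = exp(−1/x)` for `x > 0`,
`h(x) = 0` for `x ≤ 0`, belongs to the Gevrey class `G₃` on `[−1,1]`:
`|h^{(n)}(x)| ≤ A·K^n·n^(3n)` there, for some constants `A, K ≥ 1`. -/
theorem stmt_15 (h : ℝ → ℝ)
    (h_pos : ∀ x : ℝ, 0 < x → h x = Real.exp (-1 / x))
    (h_nonpos : ∀ x : ℝ, x ≤ 0 → h x = 0) :
    ∃ A K : ℝ, 1 ≤ A ∧ 1 ≤ K ∧
      ∀ n : ℕ, ∀ x ∈ Set.Icc (-1 : ℝ) 1,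
        |iteratedDeriv n h x| ≤ A * K ^ n * (n : ℝ) ^ ((n : ℝ) * 3) := by
  have hh : h = fun x : ℝ ↦ x⁻¹ ^ 0 * expNegInvGlue x := by
    funext x
    rcases le_or_gt x 0 with hx | hx
    · simp [h_nonpos x hx, expNegInvGlue.zero_of_nonpos hx]
    · simp [h_pos x hx, expNegInvGlue, hx.not_ge, neg_div]
  refine ⟨1, 8, le_rfl, by norm_num, fun n x _ ↦ ?_⟩
  have hb := abs_iteratedDeriv_inv_pow_mul_expNegInvGlue_le n 0 x
  rw [← hh, zero_add] at hb
  have hf : ((2 * n).factorial : ℝ) ≤ 4 ^ n * (n : ℝ) ^ (n * 3) := by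
    exact_mod_cast factorial_two_mul_le n
  have hr : (n : ℝ) ^ ((n : ℝ) * 3) = (n : ℝ) ^ (n * 3) := by
    rw [← Real.rpow_natCast]
    norm_num
  calc |iteratedDeriv n h x| ≤ 2 ^ n * ((2 * n).factorial : ℝ) := hb
    _ ≤ 2 ^ n * (4 ^ n * (n : ℝ) ^ (n * 3)) := by gcongr
    _ = 1 * 8 ^ n * (n : ℝ) ^ ((n : ℝ) * 3) := by
      rw [hr, ← mul_assoc, ← mul_pow]
      norm_num
end

section
/- Let ℓ ≥ 1 and N ≥ 1 be natural numbers and k ∈ ℕ, and define g : ℝ → ℝ by g(x) := exp(−(N^ℓ·x − k)²)/exp(1 + N·ℓ/e). Then for every j ∈ ℕ and every x ∈ ℝ: |g^{(j)}(x)| ≤ j^(j·(ℓ+1)) (with the convention 0^0 = 1). In particular g satisfies the Gevrey bound with parameters (ℓ+1, 1, 1) on [−1,1]. -/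
theorem iteratedDeriv_re_comp_ofReal {f : ℂ → ℂ} (hf : ContDiff ℂ ⊤ f) (n : ℕ) :
    iteratedDeriv n (fun x : ℝ => (f x).re) = fun x : ℝ => (iteratedDeriv n f x).re := by
  induction n with
  | zero => simp
  | succ n ih =>
    funext x
    rw [iteratedDeriv_succ, ih, iteratedDeriv_succ]
    have hd : Differentiable ℂ (iteratedDeriv n f) :=
      hf.differentiable_iteratedDeriv n (by exact_mod_cast WithTop.coe_lt_top _)
    exact (hd x).hasDerivAt.real_of_complex.deriv

theorem norm_exp_neg_sq_le {z : ℂ} (hz : |z.im| ≤ 1) :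
    ‖Complex.exp (-z ^ 2)‖ ≤ Real.exp 1 := by
  rw [Complex.norm_exp, Real.exp_le_exp]
  have him : z.im ^ 2 ≤ 1 := (sq_le_one_iff_abs_le_one _).2 hz
  simp only [Complex.neg_re, sq, Complex.mul_re] at him ⊢
  nlinarith [mul_self_nonneg z.re]

theorem pow_le_pow_self_mul_exp_div {a : ℝ} (ha : 0 ≤ a) (j : ℕ) :
    a ^ j ≤ (j : ℝ) ^ j * Real.exp (a / Real.exp 1) := by
  rcases Nat.eq_zero_or_pos j with rfl | hj
  · simpa using by positivity
  have hj' : (0 : ℝ) < j := by exact_mod_cast hj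
  have key : a / j ≤ Real.exp (a / Real.exp 1 / j) := by
    have h := Real.add_one_le_exp (a / Real.exp 1 / j - 1)
    rw [Real.exp_sub, sub_add_cancel, le_div_iff₀ (Real.exp_pos 1)] at h
    calc a / j = a / Real.exp 1 / j * Real.exp 1 := by field_simp
      _ ≤ _ := h
  calc a ^ j = (j : ℝ) ^ j * (a / j) ^ j := by rw [← mul_pow]; congr 1; field_simp
    _ ≤ (j : ℝ) ^ j * Real.exp (a / Real.exp 1 / j) ^ j := by gcongr
    _ = _ := by rw [← Real.exp_nat_mul]; congr 2; field_simp

/-- The Cauchy estimate on circles of radius `1 / M`. -/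
theorem abs_iteratedDeriv_exp_neg_sq_div_le {M : ℝ} (hM : 0 < M) (k C : ℝ) (j : ℕ) (x : ℝ) :
    |iteratedDeriv j (fun x : ℝ => Real.exp (-(M * x - k) ^ 2) / Real.exp C) x| ≤
      j.factorial * M ^ j * (Real.exp 1 / Real.exp C) := by
  let f : ℂ → ℂ := fun z => Complex.exp (-((M : ℂ) * z - k) ^ 2) / (Real.exp C : ℂ)
  have hf : ContDiff ℂ ⊤ f := by
    unfold f
    fun_prop
  have hre : (fun x : ℝ => Real.exp (-(M * x - k) ^ 2) / Real.exp C) =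
      fun x : ℝ => (f x).re := by
    funext y
    unfold f
    norm_cast
  rw [hre, iteratedDeriv_re_comp_ofReal hf]
  refine (Complex.abs_re_le_norm _).trans ?_
  have hR : 0 < M⁻¹ := inv_pos.2 hM
  refine (Complex.norm_iteratedDeriv_le_of_forall_mem_sphere_norm_le
    (C := Real.exp 1 / Real.exp C) j hR
    (hf.differentiable (by simp)).diffContOnCl ?_).trans_eq ?_
  · intro z hz
    unfold f
    rw [norm_div, Complex.norm_real, Real.norm_of_nonneg (Real.exp_pos C).le]
    gcongr
    apply norm_exp_neg_sq_le
    have h1 : ((M : ℂ) * z - k).im = M * (z - x).im := by simp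
    rw [h1, abs_mul, abs_of_pos hM]
    have h2 := Complex.abs_im_le_norm (z - x)
    rw [mem_sphere_iff_norm.1 hz] at h2
    calc M * |(z - x).im| ≤ M * M⁻¹ := by gcongr
      _ = 1 := mul_inv_cancel₀ hM.ne'
  · rw [inv_pow, div_inv_eq_mul]
    ring

/-- Example 9(c): for naturals `ℓ, N ≥ 1` and `k`, the scaled shifted Gaussian
`g(x) = exp(−(N^ℓ·x − k)²)/exp(1 + N·ℓ/e)` satisfies `|g^{(j)}(x)| ≤ j^(j(ℓ+1))`
for all `j` and all real `x`; in particular `g ∈ G_{ℓ+1,1,1}[−1,1]`. -/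
theorem stmt_16 (ℓ N : ℕ) (hℓ : 1 ≤ ℓ) (hN : 1 ≤ N) (k : ℕ) (g : ℝ → ℝ)
    (hg : ∀ x : ℝ, g x =
      Real.exp (-((N : ℝ) ^ ℓ * x - (k : ℝ)) ^ 2) /
        Real.exp (1 + (N : ℝ) * (ℓ : ℝ) / Real.exp 1)) :
    ∀ j : ℕ, ∀ x : ℝ,
      |iteratedDeriv j g x| ≤ (j : ℝ) ^ ((j : ℝ) * ((ℓ : ℝ) + 1)) := by
  intro j x
  have hN' : (0 : ℝ) < N := by exact_mod_cast hN
  rw [funext hg]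
  refine (abs_iteratedDeriv_exp_neg_sq_div_le (pow_pos hN' ℓ) k _ j x).trans ?_
  have hpow : ((N : ℝ) ^ ℓ) ^ j ≤
      ((j : ℝ) ^ j) ^ ℓ * Real.exp ((N : ℝ) * ℓ / Real.exp 1) := by
    calc ((N : ℝ) ^ ℓ) ^ j = ((N : ℝ) ^ j) ^ ℓ := by rw [← pow_mul, ← pow_mul, mul_comm]
      _ ≤ ((j : ℝ) ^ j * Real.exp ((N : ℝ) / Real.exp 1)) ^ ℓ := by
        gcongr
        exact pow_le_pow_self_mul_exp_div hN'.le j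
      _ = _ := by
        rw [mul_pow, ← Real.exp_nat_mul]
        congr 2
        ring
  have hfac : (j.factorial : ℝ) ≤ (j : ℝ) ^ j := by exact_mod_cast j.factorial_le_pow
  have hexp : (j : ℝ) ^ ((j : ℝ) * ((ℓ : ℝ) + 1)) = (j : ℝ) ^ j * ((j : ℝ) ^ j) ^ ℓ := by
    rw [← pow_succ', ← pow_mul, ← Real.rpow_natCast]
    push_cast
    rfl
  rw [hexp, Real.exp_add]
  calc _ ≤ (j : ℝ) ^ j * (((j : ℝ) ^ j) ^ ℓ * Real.exp ((N : ℝ) * ℓ / Real.exp 1)) *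
        (Real.exp 1 / (Real.exp 1 * Real.exp ((N : ℝ) * ℓ / Real.exp 1))) := by gcongr
    _ = _ := by field_simp
end

section
/- For every natural number N ≥ 1: exp(−(ln N)²) − exp(−(ln(N+1))²) ≥ exp(−(ln N)² − ln N − 1). -/
/-- If `x * d ≥ 1 + d` with `d ≥ 0` and `x > 0`, then `x⁻¹ ≤ 1 - exp (-d)`. -/
lemma inv_le_one_sub_exp_neg {x d : ℝ} (hx : 0 < x) (hd : 0 ≤ d) (h : 1 + d ≤ x * d) :
    x⁻¹ ≤ 1 - Real.exp (-d) := by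
  have h1 : Real.exp (-d) ≤ (1 + d)⁻¹ := by
    rw [Real.exp_neg]
    exact inv_anti₀ (by linarith) (by linarith [Real.add_one_le_exp d])
  have h2 : x⁻¹ ≤ 1 - (1 + d)⁻¹ := by
    have h3 : 1 - (1 + d)⁻¹ = d / (1 + d) := by
      field_simp
      ring
    rw [h3, inv_eq_one_div, div_le_div_iff₀ hx (by linarith)]
    linarith
  linarith

lemma exp_neg_one_le_one_sub_exp_neg_log_two_sq :
    Real.exp (-1) ≤ 1 - Real.exp (-(Real.log 2) ^ 2) := by
  have hb : 0.48 ≤ Real.log 2 ^ 2 := by nlinarith [Real.log_two_gt_d9]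
  have h1 : (1.595 : ℝ) ≤ Real.exp (Real.log 2 ^ 2) := by
    have := Real.quadratic_le_exp_of_nonneg (sq_nonneg (Real.log 2))
    nlinarith
  have h2 : Real.exp (-(Real.log 2) ^ 2) ≤ (1.595 : ℝ)⁻¹ := by
    rw [Real.exp_neg]
    exact inv_anti₀ (by norm_num) h1
  have h3 : (1.595 : ℝ)⁻¹ ≤ 0.63 := by norm_num
  linarith [Real.exp_neg_one_lt_d9]

/-- The gap between consecutive values of `(log x) ^ 2` is at least `2 * log 2 / (x + 1)`. -/
lemma two_mul_log_two_le_mul_log_sq_sub {x : ℝ} (hx : 2 ≤ x) :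
    2 * Real.log 2 ≤ (x + 1) * (Real.log (x + 1) ^ 2 - Real.log x ^ 2) := by
  have hx0 : 0 < x := by linarith
  have ha : Real.log 2 ≤ Real.log x := Real.log_le_log (by norm_num) hx
  have hb : Real.log x ≤ Real.log (x + 1) := Real.log_le_log hx0 (by linarith)
  have hgap : 1 ≤ (x + 1) * (Real.log (x + 1) - Real.log x) := by
    have h := Real.one_sub_inv_le_log_of_pos (show 0 < (x + 1) / x by positivity)
    rw [Real.log_div (by positivity) hx0.ne', inv_div] at h
    have h' := mul_le_mul_of_nonneg_left h (show 0 ≤ x + 1 by linarith)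
    have h1 : (x + 1) * (1 - x / (x + 1)) = 1 := by
      field_simp
      ring
    linarith
  have hl : 0 < Real.log 2 := Real.log_pos (by norm_num)
  have := mul_le_mul_of_nonneg_right hgap
    (show 0 ≤ Real.log (x + 1) + Real.log x by linarith)
  nlinarith

/-- Key estimate of Example 8(b):
`exp(−(ln N)²) − exp(−(ln(N+1))²) ≥ exp(−(ln N)² − ln N − 1)` for every `N ≥ 1`. -/
theorem stmt_18 (N : ℕ) (hN : 1 ≤ N) :
    Real.exp (-(Real.log N) ^ 2) - Real.exp (-(Real.log ((N : ℝ) + 1)) ^ 2) ≥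
      Real.exp (-(Real.log N) ^ 2 - Real.log N - 1) := by
  rcases hN.eq_or_lt with rfl | h2
  · have := exp_neg_one_le_one_sub_exp_neg_log_two_sq
    norm_num
    linarith
  have hx : (2 : ℝ) ≤ N := by exact_mod_cast h2
  generalize (N : ℝ) = x at hx
  have hx0 : 0 < x := by linarith
  have hgap := two_mul_log_two_le_mul_log_sq_sub hx
  set d := Real.log (x + 1) ^ 2 - Real.log x ^ 2 with hd
  have hl := Real.log_two_gt_d9
  have hd0 : 0 ≤ d := by
    by_contra! h
    nlinarith
  have he := Real.exp_one_gt_d9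
  have hmain : (x * Real.exp 1)⁻¹ ≤ 1 - Real.exp (-d) := by
    refine inv_le_one_sub_exp_neg (by positivity) hd0 ?_
    have : 2.7 * (x * d) ≤ x * Real.exp 1 * d := by
      nlinarith [mul_nonneg hx0.le hd0]
    nlinarith
  have e1 : Real.exp (-(Real.log (x + 1)) ^ 2) =
      Real.exp (-(Real.log x) ^ 2) * Real.exp (-d) := by
    rw [← Real.exp_add, hd]
    ring_nf
  have e2 : Real.exp (-(Real.log x) ^ 2 - Real.log x - 1) =
      Real.exp (-(Real.log x) ^ 2) * (x * Real.exp 1)⁻¹ := by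
    rw [Real.exp_sub, Real.exp_sub, Real.exp_log hx0]
    field_simp
  rw [e1, e2]
  have := mul_le_mul_of_nonneg_left hmain (Real.exp_pos (-(Real.log x) ^ 2)).le
  linarith
end

section
/- For every natural number n there exists a family (f_w) of functions f_w : ℝ → ℝ, indexed by the 2^(2^n) binary strings w of length 2^n (i.e. by w : Fin(2^n) → Bool), such that: each f_w maps [0,1] into [0,1]; each f_w is non-expansive on [0,1], i.e. |f_w(x) − f_w(y)| ≤ |x − y| for all x, y ∈ [0,1]; and for all w ≠ v there exists x ∈ [0,1] with |f_w(x) − f_v(x)| ≥ 2^(−n−1). -/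
/-- The distance to the far point `-1` and the odd multiples `(2 i + 1) h` selected by `w`,
truncated at height `h`. -/
noncomputable def truncatedDist {N : ℕ} (h : ℝ) (w : Fin N → Bool) (x : ℝ) : ℝ :=
  min h (Metric.infDist x (insert (-1) {c | ∃ i, w i = true ∧ c = (2 * (i : ℝ) + 1) * h}))

section truncatedDist

variable {N : ℕ} {h : ℝ} (w : Fin N → Bool)

theorem truncatedDist_nonneg (hh : 0 ≤ h) (x : ℝ) : 0 ≤ truncatedDist h w x :=
  le_min hh Metric.infDist_nonneg

theorem truncatedDist_le (x : ℝ) : truncatedDist h w x ≤ h :=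
  min_le_left _ _

theorem abs_truncatedDist_sub_le (x y : ℝ) :
    |truncatedDist h w x - truncatedDist h w y| ≤ |x - y| := by
  have hl := ((Metric.lipschitz_infDist_pt
    (insert (-1) {c : ℝ | ∃ i, w i = true ∧ c = (2 * (i : ℝ) + 1) * h})).const_min h).dist_le_mul
      x y
  simpa [truncatedDist, Real.dist_eq] using hl

theorem truncatedDist_of_eq_true (hh : 0 ≤ h) {i : Fin N} (hi : w i = true) :
    truncatedDist h w ((2 * (i : ℝ) + 1) * h) = 0 := by
  have hmem : (2 * (i : ℝ) + 1) * h ∈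
      insert (-1) {c : ℝ | ∃ i, w i = true ∧ c = (2 * (i : ℝ) + 1) * h} :=
    Or.inr ⟨i, hi, rfl⟩
  rw [truncatedDist, Metric.infDist_zero_of_mem hmem]
  exact min_eq_right hh

theorem truncatedDist_of_eq_false (hh : 0 ≤ h) {i : Fin N} (hi : w i = false) :
    truncatedDist h w ((2 * (i : ℝ) + 1) * h) = h := by
  refine min_eq_left ((Metric.le_infDist (Set.insert_nonempty _ _)).2 ?_)
  rintro c (rfl | ⟨j, hj, rfl⟩)
  · have : 0 ≤ (i : ℝ) * h := by positivity
    rw [Real.dist_eq]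
    exact le_trans (by linarith) (le_abs_self _)
  · have hij : (i : ℤ) - j ≠ 0 := by
      intro hij
      have : i = j := Fin.ext (by omega)
      simp_all
    have h1 : (1 : ℝ) ≤ |(i : ℝ) - j| := by
      exact_mod_cast Int.one_le_abs hij
    rw [Real.dist_eq, show (2 * (i : ℝ) + 1) * h - (2 * (j : ℝ) + 1) * h
      = 2 * h * ((i : ℝ) - j) by ring, abs_mul, abs_of_nonneg (by positivity)]
    nlinarith

theorem le_abs_truncatedDist_sub {w v : Fin N → Bool} (hh : 0 ≤ h) {i : Fin N}
    (hi : w i ≠ v i) :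
    h ≤ |truncatedDist h w ((2 * (i : ℝ) + 1) * h)
      - truncatedDist h v ((2 * (i : ℝ) + 1) * h)| := by
  cases hw : w i
  · have hv : v i = true := by simpa [hw] using hi
    rw [truncatedDist_of_eq_false w hh hw, truncatedDist_of_eq_true v hh hv, sub_zero]
    exact le_abs_self h
  · have hv : v i = false := by simpa [hw] using hi
    rw [truncatedDist_of_eq_true w hh hw, truncatedDist_of_eq_false v hh hv, zero_sub, abs_neg]
    exact le_abs_self h

end truncatedDist


/-- Exponential width of `Lip₁([0,1],[0,1])`: for every `n` there are `2^(2^n)` non-expansive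
self-maps of `[0,1]`, indexed by binary strings `w` of length `2^n`, that are pairwise
uniformly separated by `2^(−n−1)` in sup-norm on `[0,1]`. -/
theorem stmt_19 (n : ℕ) :
    ∃ f : (Fin (2 ^ n) → Bool) → ℝ → ℝ,
      (∀ w, Set.MapsTo (f w) (Set.Icc (0 : ℝ) 1) (Set.Icc (0 : ℝ) 1)) ∧
      (∀ w, ∀ x ∈ Set.Icc (0 : ℝ) 1, ∀ y ∈ Set.Icc (0 : ℝ) 1,
        |f w x - f w y| ≤ |x - y|) ∧
      (∀ w v, w ≠ v → ∃ x ∈ Set.Icc (0 : ℝ) 1,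
        (2 : ℝ) ^ (-(n : ℝ) - 1) ≤ |f w x - f v x|) := by
  set h : ℝ := (2 : ℝ) ^ (-(n : ℝ) - 1) with hdef
  have hpos : 0 < h := by positivity
  have hmul : (2 : ℝ) ^ n * (2 * h) = 1 := by
    rw [hdef, Real.rpow_sub two_pos, Real.rpow_neg two_pos.le, Real.rpow_natCast, Real.rpow_one]
    field_simp
  have hle : h ≤ 1 := by
    have : (1 : ℝ) ≤ 2 ^ n := one_le_pow₀ one_le_two
    nlinarith
  refine ⟨truncatedDist h, fun w x _ => ⟨truncatedDist_nonneg w hpos.le x,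
    (truncatedDist_le w x).trans hle⟩, fun w x _ y _ => abs_truncatedDist_sub_le w x y,
    fun w v hwv => ?_⟩
  obtain ⟨i, hi⟩ := Function.ne_iff.1 hwv
  refine ⟨(2 * (i : ℝ) + 1) * h, ⟨by positivity, ?_⟩, le_abs_truncatedDist_sub hpos.le hi⟩
  have hlt : (i : ℝ) + 1 ≤ 2 ^ n := by exact_mod_cast i.isLt
  nlinarith
end
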